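/- Let p and q be odd primes with p = q, let m ≥ 1, and let x, y be coprime positive integers with x² + q^(2m) = 2·y^p. Then p ≤ 3089. -/

import Mathlib

/-- `δ₄ = 1` if `p ≡ 1 (mod 4)` and `δ₄ = -1` if `p ≡ 3 (mod 4)`. -/
def d4 (p : ℕ) : ℤ := if p % 4 = 1 then 1 else -1

/-- `δ₈ = 1` if `p ≡ 1, 3 (mod 8)` and `δ₈ = -1` if `p ≡ 5, 7 (mod 8)`. -/
def d8 (p : ℕ) : ℤ := if p % 8 = 1 ∨ p % 8 = 3 then 1 else -1

/-- `F_p(u,v) = Re((1+i)(u+iv)^p)`. -/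
def Ffun (p : ℕ) (u v : ℤ) : ℤ :=
  ((⟨1, 1⟩ : GaussianInt) * (⟨u, v⟩ : GaussianInt) ^ p).re

/-- `G_p(u,v) = Im((1+i)(u+iv)^p)`. -/
def Gfun (p : ℕ) (u v : ℤ) : ℤ :=
  ((⟨1, 1⟩ : GaussianInt) * (⟨u, v⟩ : GaussianInt) ^ p).im

/-- `H_p(u,v) = G_p(u,v)/(u + δ₄ v)` (exact division whenever `u + δ₄ v ≠ 0`). -/
def Hfun (p : ℕ) (u v : ℤ) : ℤ := Gfun p u v / (u + d4 p * v)


section APart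

lemma wt_sum_ge {ι : Type*} [Fintype ι] [DecidableEq ι] {D : ℕ} (f : ι → Option (Fin D))
    (hf : ∀ i j m, f i = some m → f j = some m → i = j) :
    Fintype.card ι * (Fintype.card ι - 1) / 2 ≤
      ∑ i, (match f i with | none => Fintype.card ι | some m => (m : ℕ)) := by
  classical
  set N := Fintype.card ι with hN
  set w : ι → ℕ := fun i => (match f i with | none => N | some m => (m : ℕ)) with hw
  set A := Finset.univ.filter (fun i => w i < N) with hA
  have hinj : Set.InjOn w A := by
    intro i hi j hj hij
    simp only [hA, Finset.coe_filter, Finset.mem_univ, true_and, Set.mem_ofPred_eq] at hi hj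
    rcases h1 : f i with _ | a
    · simp [hw, h1] at hi
    rcases h2 : f j with _ | b
    · simp [hw, h2] at hj
    simp only [hw, h1, h2] at hij
    have : a = b := Fin.ext hij
    subst this
    exact hf i j a h1 h2
  have himg : A.image w ⊆ Finset.range N := by
    intro m hm
    simp only [Finset.mem_image, hA, Finset.mem_filter] at hm
    obtain ⟨i, hi, rfl⟩ := hm
    simpa using hi.2
  have h1 : ∑ m ∈ Finset.range N, m = N * (N - 1) / 2 := by
    rw [Finset.sum_range_id]
  rw [← h1, ← Finset.sum_sdiff himg, Finset.sum_image hinj,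
    ← Finset.sum_filter_add_sum_filter_not Finset.univ (fun i => w i < N) w, add_comm]
  apply Nat.add_le_add le_rfl
  calc ∑ m ∈ Finset.range N \ A.image w, m ≤ ∑ m ∈ Finset.range N \ A.image w, N := by
        apply Finset.sum_le_sum
        intro m hm
        have := (Finset.mem_sdiff.1 hm).1
        exact (Finset.mem_range.1 this).le
    _ = (N - A.card) * N := by
        rw [Finset.sum_const, Finset.card_sdiff_of_subset himg, Finset.card_image_of_injOn hinj]
        simp
    _ = ∑ i with ¬ w i < N, N := by
        rw [Finset.sum_const, ← Finset.compl_filter, Finset.card_compl]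
        simp [hA, hN]
    _ ≤ _ := by
        apply Finset.sum_le_sum
        intro i hi
        simpa using hi

lemma det_norm_le {ι : Type*} [Fintype ι] [DecidableEq ι] (M : Matrix ι ι ℂ) (B : ι → ℝ)
    (h : ∀ i j, ‖M i j‖ ≤ B i) : ‖M.det‖ ≤ (Fintype.card ι).factorial * ∏ i, B i := by
  rw [← Matrix.det_transpose, Matrix.det_apply]
  calc _ ≤ ∑ σ : Equiv.Perm ι, ‖Equiv.Perm.sign σ • ∏ i, M.transpose (σ i) i‖ := norm_sum_le _ _
    _ ≤ ∑ σ : Equiv.Perm ι, ∏ i, B i := by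
        apply Finset.sum_le_sum
        intro σ _
        have : ‖Equiv.Perm.sign σ • ∏ i, M.transpose (σ i) i‖ = ‖∏ i, M.transpose (σ i) i‖ := by
          rcases Int.units_eq_one_or (Equiv.Perm.sign σ) with h | h <;> simp [h]
        rw [this, norm_prod]
        apply Finset.prod_le_prod
        · intros; positivity
        · intro i _
          exact h _ _
    _ = _ := by
        simp [Finset.sum_const, Fintype.card_perm]

lemma det_bound {ι : Type*} [Fintype ι] [DecidableEq ι] {D : ℕ} (c : ι → Fin D → ℂ)
    (x : ι → ℂ) (M R : Matrix ι ι ℂ)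
    (hM : ∀ i j, M i j = ∑ m, c i m * x j ^ (m : ℕ) + R i j) (X ρ : ℝ) (hX : 0 ≤ X) (hρ : 1 ≤ ρ)
    (hx : ∀ j, ‖x j‖ ≤ X) (E : ι → ℝ) (hE : ∀ i, 0 ≤ E i)
    (hR : ∀ i j, ‖R i j‖ ≤ E i / ρ ^ Fintype.card ι) :
    ‖M.det‖ ≤ (Fintype.card ι).factorial * (∏ i, (∑ m, ‖c i m‖ * (ρ * X) ^ (m : ℕ) + E i))
      / ρ ^ (Fintype.card ι * (Fintype.card ι - 1) / 2) := by
  classical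
  have hρ0 : 0 < ρ := by linarith
  set N := Fintype.card ι with hN
  let W : ι → Option (Fin D) → ι → ℂ := fun i o => match o with
    | none => R i
    | some m => fun j => c i m * x j ^ (m : ℕ)
  let b : ι → Option (Fin D) → ℝ := fun i o => match o with
    | none => E i
    | some m => ‖c i m‖ * (ρ * X) ^ (m : ℕ)
  let wt : Option (Fin D) → ℕ := fun o => match o with
    | none => N
    | some m => (m : ℕ)
  have hb : ∀ i o, 0 ≤ b i o := by
    intro i o
    rcases o with _ | m
    · exact hE i
    · simp only [b]; positivity
  have hW : ∀ i o j, ‖W i o j‖ ≤ b i o / ρ ^ wt o := by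
    intro i o j
    rcases o with _ | m
    · exact hR i j
    · simp only [W, b, wt]
      rw [norm_mul, norm_pow, mul_pow, mul_div_assoc, mul_div_cancel_left₀ _ (by positivity)]
      gcongr
      exact hx j
  have hMW : M = fun i => ∑ o, W i o := by
    funext i j
    rw [hM i j, Finset.sum_apply, Fintype.sum_option, add_comm]
  have hdet : M.det = ∑ f : ι → Option (Fin D), Matrix.det (Matrix.of fun i => W i (f i)) := by
    rw [hMW]
    exact (Matrix.detRowAlternating (R := ℂ) (n := ι)).toMultilinearMap.map_sum
      (fun i o => W i o)
  rw [hdet]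
  have hterm : ∀ f : ι → Option (Fin D), ‖Matrix.det (Matrix.of fun i => W i (f i))‖ ≤
      N.factorial * (∏ i, b i (f i)) / ρ ^ (N * (N - 1) / 2) := by
    intro f
    by_cases hf : ∀ i j m, f i = some m → f j = some m → i = j
    · have h1 := det_norm_le (Matrix.of fun i => W i (f i)) (fun i => b i (f i) / ρ ^ wt (f i))
        (fun i j => hW i (f i) j)
      refine h1.trans ?_
      rw [Finset.prod_div_distrib, ← mul_div_assoc, Finset.prod_pow_eq_pow_sum]
      have := wt_sum_ge f hf
      have h2 : 0 ≤ ∏ i, b i (f i) := Finset.prod_nonneg (fun i _ => hb i _)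
      gcongr
    · push Not at hf
      obtain ⟨i, j, m, hi, hj, hij⟩ := hf
      have : Matrix.det (Matrix.of fun i => W i (f i)) = 0 := by
        by_cases hc : c i m = 0
        · apply Matrix.det_eq_zero_of_row_eq_zero i
          intro k
          simp [W, hi, hc]
        · apply Matrix.exists_vecMul_eq_zero_iff.1
          refine ⟨Pi.single i (c j m) - Pi.single j (c i m), ?_, ?_⟩
          · intro h0
            have := congrFun h0 j
            simp [hij.symm] at this
            exact hc this
          · rw [Matrix.sub_vecMul, Matrix.single_vecMul, Matrix.single_vecMul]
            funext l
            simp only [Matrix.row, Matrix.of_apply, Pi.sub_apply, Pi.smul_apply, smul_eq_mul, hi, hj, W,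
              Pi.zero_apply]
            ring
      rw [this, norm_zero]
      have h2 : 0 ≤ ∏ i, b i (f i) := Finset.prod_nonneg (fun i _ => hb i _)
      positivity
  calc _ ≤ ∑ f : ι → Option (Fin D), ‖Matrix.det (Matrix.of fun i => W i (f i))‖ := norm_sum_le _ _
    _ ≤ ∑ f : ι → Option (Fin D), N.factorial * (∏ i, b i (f i)) / ρ ^ (N * (N - 1) / 2) :=
        Finset.sum_le_sum (fun f _ => hterm f)
    _ = _ := by
        rw [← Finset.sum_div, ← Finset.mul_sum]
        congr 2
        rw [← Fintype.prod_sum (fun i o => b i o)]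
        apply Finset.prod_congr rfl
        intro i _
        rw [Fintype.sum_option, add_comm]

end APart

section BPart

lemma exists_minor {ι κ : Type*} [Fintype ι] [DecidableEq ι] [Fintype κ] (M : Matrix ι κ ℂ)
    (h : LinearIndependent ℂ M.row) : ∃ e : ι → κ, (M.submatrix id e).det ≠ 0 := by
  classical
  have hr : M.rank = Fintype.card ι := LinearIndependent.rank_matrix h
  rw [Matrix.rank_eq_finrank_span_cols] at hr
  have htop : Submodule.span ℂ (Set.range M.col) = ⊤ := by
    apply Submodule.eq_top_of_finrank_eq
    rw [hr]; simp
  obtain ⟨κ', a, ha, hspan, hli⟩ := exists_linearIndependent' ℂ M.col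
  rw [htop] at hspan
  let B := Module.Basis.mk hli hspan.ge
  let e := (Pi.basisFun ℂ ι).indexEquiv B
  refine ⟨fun i => a (e i), ?_⟩
  have h3 : LinearIndependent ℂ (M.submatrix id (fun i => a (e i))).col := hli.comp e e.injective
  have := Matrix.linearIndependent_cols_iff_isUnit.1 h3
  exact ((Matrix.isUnit_iff_isUnit_det _).1 this).ne_zero

open Polynomial in
lemma zero_estimate {K L : ℕ} {β : Type*} [Fintype β] (P : Fin K → ℂ[X])
    (hP : LinearIndependent ℂ P) (hdeg : ∀ k, (P k).natDegree ≤ K - 1)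
    (xb ηb : β → ℂ) (hxb : Function.Injective xb) (hηb : ∀ b, ηb b ≠ 0)
    (hcard : L * (K - 1) < Fintype.card β)
    (xt ηt : Fin L → ℂ) (hηt : Function.Injective ηt)
    (c : Fin K → Fin L → ℂ)
    (h : ∀ b t, ∑ k, ∑ l, c k l * ((P k).eval (xb b + xt t) * (ηb b * ηt t) ^ (l : ℕ)) = 0) :
    c = 0 := by
  classical
  let p : Fin L → ℂ[X] := fun l => ∑ k, c k l • P k
  by_cases hz : ∀ l, p l = 0
  · funext k l
    exact Fintype.linearIndependent_iff.1 hP (fun k => c k l) (hz l) k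
  exfalso
  push Not at hz
  obtain ⟨l0, hl0⟩ := hz
  let Λ := {l : Fin L // p l ≠ 0}
  have hV : LinearIndependent ℂ (Matrix.vandermonde ηt).transpose.row := by
    have h0 : (Matrix.vandermonde ηt).transpose.det ≠ 0 := by
      rw [Matrix.det_transpose]
      exact Matrix.det_vandermonde_ne_zero_iff.2 hηt
    exact Matrix.linearIndependent_rows_of_det_ne_zero h0
  obtain ⟨e, he⟩ := exists_minor (fun (l : Λ) (t : Fin L) => ηt t ^ (l.1 : ℕ))
    (hV.comp (fun l : Λ => l.1) Subtype.val_injective)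
  let Mat : Matrix Λ Λ ℂ[X] := Matrix.of fun t l =>
    C (ηt (e t) ^ (l.1 : ℕ)) * taylor (xt (e t)) (p l.1)
  have hdegp : ∀ l, (p l).natDegree ≤ K - 1 := by
    intro l
    apply natDegree_sum_le_of_forall_le
    intro k _
    exact (natDegree_smul_le _ _).trans (hdeg k)
  let d := ∑ l : Λ, (p l.1).natDegree
  have hprod : ∀ σ : Equiv.Perm Λ, (∏ l, Mat (σ l) l) =
      C (∏ l : Λ, ηt (e (σ l)) ^ (l.1 : ℕ)) * ∏ l : Λ, taylor (xt (e (σ l))) (p l.1) := by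
    intro σ
    simp only [Mat, Matrix.of_apply, Finset.prod_mul_distrib, map_prod]
  have hnd : ∀ σ : Equiv.Perm Λ, (∏ l : Λ, taylor (xt (e (σ l))) (p l.1)).natDegree = d := by
    intro σ
    rw [natDegree_prod]
    · simp [d, natDegree_taylor]
    · intro l _ h0
      exact l.2 ((taylor_eq_zero _ _).1 h0)
  have hlc : ∀ σ : Equiv.Perm Λ, (∏ l : Λ, taylor (xt (e (σ l))) (p l.1)).coeff d =
      ∏ l : Λ, (p l.1).leadingCoeff := by
    intro σ
    rw [← hnd σ]
    change leadingCoeff _ = _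
    rw [leadingCoeff_prod]
    simp [leadingCoeff_taylor]
  have hcoeff : Mat.det.coeff d = (∏ l : Λ, (p l.1).leadingCoeff) *
      (Matrix.det (Matrix.of fun (t l : Λ) => ηt (e t) ^ (l.1 : ℕ))) := by
    rw [Matrix.det_apply', Matrix.det_apply', finsetSum_coeff, Finset.mul_sum]
    apply Finset.sum_congr rfl
    intro σ _
    rw [hprod, ← mul_assoc, ← C_eq_intCast, ← C_mul, coeff_C_mul, hlc]
    simp only [Matrix.of_apply]
    ring
  have hne : Mat.det ≠ 0 := by
    intro h0
    rw [h0, coeff_zero] at hcoeff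
    rcases mul_eq_zero.1 hcoeff.symm with h1 | h1
    · rw [Finset.prod_eq_zero_iff] at h1
      obtain ⟨l, _, hl⟩ := h1
      exact l.2 (leadingCoeff_eq_zero.1 hl)
    · apply he
      rw [← Matrix.det_transpose]
      exact h1
  have hdle : Mat.det.natDegree ≤ L * (K - 1) := by
    have h1 : d ≤ L * (K - 1) := by
      calc d ≤ ∑ l : Λ, (K - 1) := Finset.sum_le_sum (fun l _ => hdegp _)
        _ = Fintype.card Λ * (K - 1) := by simp
        _ ≤ _ := by
          apply Nat.mul_le_mul_right
          exact (Fintype.card_subtype_le (fun l : Fin L => p l ≠ 0)).trans (by simp)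
    refine le_trans ?_ h1
    rw [Matrix.det_apply']
    apply natDegree_sum_le_of_forall_le
    intro σ _
    rw [hprod, ← mul_assoc, ← C_eq_intCast, ← C_mul]
    exact (natDegree_C_mul_le _ _).trans (hnd σ).le
  have hroot : ∀ b, Mat.det.eval (xb b) = 0 := by
    intro b
    have h1 : Mat.det.eval (xb b) = (Mat.map (evalRingHom (xb b))).det := by
      rw [← coe_evalRingHom, RingHom.map_det]; rfl
    rw [h1]
    apply Matrix.exists_mulVec_eq_zero_iff.1
    refine ⟨fun l => ηb b ^ (l.1 : ℕ), ?_, ?_⟩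
    · intro h0
      have := congrFun h0 ⟨l0, hl0⟩
      simp [hηb b] at this
    · funext t
      have h2 := h b (e t)
      rw [Finset.sum_comm] at h2
      simp only [Matrix.mulVec, dotProduct, Matrix.map_apply, Mat, Matrix.of_apply,
        coe_evalRingHom, eval_mul, eval_C, taylor_eval, Pi.zero_apply]
      rw [← h2]
      rw [← Finset.sum_subtype (Finset.univ.filter (fun l => p l ≠ 0)) (by simp)
        (fun l => ηt (e t) ^ (l : ℕ) * eval (xb b + xt (e t)) (p l) * ηb b ^ (l : ℕ))]
      rw [Finset.sum_filter_of_ne]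
      · apply Finset.sum_congr rfl
        intro l _
        simp only [p, eval_finsetSum, eval_smul, smul_eq_mul, Finset.mul_sum, Finset.sum_mul]
        apply Finset.sum_congr rfl
        intro k _
        rw [mul_pow]
        ring
      · intro l _ h3 h4
        apply h3
        simp [h4]
  have hcd := card_le_degree_of_subset_roots (p := Mat.det) (Z := Finset.univ.image xb) (by
    intro r hr
    simp only [Finset.image_val, Multiset.mem_dedup, Multiset.mem_map] at hr
    obtain ⟨b, _, rfl⟩ := hr
    rw [mem_roots hne]
    exact hroot b)
  rw [Finset.card_image_of_injective _ hxb, Finset.card_univ] at hcd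
  omega

end BPart

section CPart

lemma gauss_unit_pow_four (w : GaussianInt) (h : IsUnit w) : w ^ 4 = 1 := by
  have h1 := (Zsqrtd.norm_eq_one_iff' (by norm_num) w).2 h
  rw [Zsqrtd.norm_def] at h1
  obtain ⟨a, b⟩ := w
  simp only at h1
  have h1 : a * a + b * b = 1 := by linarith
  have ha : a ≤ 1 := by nlinarith [mul_self_nonneg b]
  have ha' : -1 ≤ a := by nlinarith [mul_self_nonneg b]
  have hb : b ≤ 1 := by nlinarith
  have hb' : -1 ≤ b := by nlinarith
  interval_cases a <;> interval_cases b <;> first | (exfalso; omega) | decide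

lemma odd_sq_mod_four {p : ℕ} (hop : Odd p) : ∃ k, p * p = 4 * k + 1 := by
  obtain ⟨k, rfl⟩ := hop
  exact ⟨k * k + k, by ring⟩

lemma gauss_root (p m x y : ℕ) (hp : Nat.Prime p) (hop : Odd p) (hm : 1 ≤ m)
    (hcop : Nat.gcd x y = 1) (heq : x ^ 2 + p ^ (2 * m) = 2 * y ^ p) :
    ∃ z : GaussianInt, (⟨x, (p : ℤ) ^ m⟩ : GaussianInt) = ⟨1, 1⟩ * z ^ p ∧ z.norm = y ∧ Odd y := by
  have hpo : Odd (p ^ m) := hop.pow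
  have hpo2 : Odd (p ^ (2 * m)) := hop.pow
  have hxo : Odd x := by
    have h1 : Even (x ^ 2 + p ^ (2 * m)) := by rw [heq]; exact even_two_mul _
    rw [Nat.even_add] at h1
    by_contra hx
    rw [Nat.not_odd_iff_even] at hx
    have : Even (x ^ 2) := hx.pow_of_ne_zero (by norm_num)
    have := h1.1 this
    exact (Nat.not_even_iff_odd.2 hpo2) this
  obtain ⟨a, ha⟩ := hxo
  obtain ⟨b, hb⟩ := hpo
  have hyo : Odd y := by
    have h1 : x ^ 2 + (p ^ m) ^ 2 = 2 * y ^ p := by rw [← heq]; ring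
    rw [hb, ha] at h1
    have h2 : y ^ p = 2 * (a * a + a + b * b + b) + 1 := by nlinarith
    have h3 : Odd (y ^ p) := ⟨_, h2⟩
    by_contra hy
    rw [Nat.not_odd_iff_even] at hy
    exact (Nat.not_even_iff_odd.2 h3) (hy.pow_of_ne_zero hp.ne_zero)
  have hbz : (p : ℤ) ^ m = 2 * b + 1 := by exact_mod_cast hb
  have haz : (x : ℤ) = 2 * a + 1 := by exact_mod_cast ha
  let w : GaussianInt := ⟨a + b + 1, b - a⟩
  have hw : (⟨x, (p : ℤ) ^ m⟩ : GaussianInt) = ⟨1, 1⟩ * w := by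
    ext
    · simp [w, haz]; ring
    · simp [w, hbz]; ring
  have hN : w.norm = (y : ℤ) ^ p := by
    have h1 : (x : ℤ) ^ 2 + ((p : ℤ) ^ m) ^ 2 = 2 * (y : ℤ) ^ p := by
      rw [← pow_mul, mul_comm m 2]; exact_mod_cast heq
    rw [hbz, haz] at h1
    simp only [Zsqrtd.norm_def, w]
    nlinarith
  have hww : w * star w = (y : GaussianInt) ^ p := by
    rw [← Zsqrtd.norm_eq_mul_conj, hN]; push_cast; rfl
  have hc : IsCoprime (2 * x : ℤ) ((y : ℤ) ^ p) := by
    apply IsCoprime.pow_right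
    have : Nat.Coprime (2 * x) y := by
      apply Nat.Coprime.mul_left
      · exact (Nat.coprime_two_left).2 hyo
      · exact hcop
    have := Nat.isCoprime_iff_coprime.2 this
    push_cast at this
    exact this
  have hcw : IsCoprime w (star w) := by
    obtain ⟨s, t, hst⟩ := hc
    have h2 : (s : GaussianInt) * (2 * x) + t * (y : GaussianInt) ^ p = 1 := by
      exact_mod_cast congrArg (Int.cast : ℤ → GaussianInt) hst
    rw [← hww] at h2
    have h3 : (2 * x : GaussianInt) = ⟨1, 1⟩ * w + ⟨1, -1⟩ * star w := by
      have : ((x : ℤ) : GaussianInt) = (x : GaussianInt) := by push_cast; rfl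
      rw [← this, haz]
      ext
      · simp [w]; ring
      · simp [w]; ring
    refine ⟨s * ⟨1, 1⟩ + t * star w, s * ⟨1, -1⟩, ?_⟩
    rw [← h2, h3]
    ring
  obtain ⟨d, u, hdu⟩ := exists_associated_pow_of_mul_eq_pow' hcw hww
  obtain ⟨k, hk⟩ := odd_sq_mod_four hop
  have hu : (u : GaussianInt) = ((u : GaussianInt) ^ p) ^ p := by
    rw [← pow_mul, hk, pow_add, pow_mul, gauss_unit_pow_four _ u.isUnit]
    simp
  refine ⟨d * u ^ p, ?_, ?_, hyo⟩
  · rw [mul_pow, ← hu, hdu, hw]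
  · have h1 : ((d * (u : GaussianInt) ^ p).norm) ^ p = (y : ℤ) ^ p := by
      rw [← hN, ← hdu]
      have : ∀ (c : GaussianInt) (n : ℕ), (c ^ n).norm = c.norm ^ n := fun c n =>
        map_pow (Zsqrtd.normMonoidHom (d := -1)) c n
      rw [← this, mul_pow, ← hu]
    exact (hop.strictMono_pow.injective) h1

lemma algebra_part (p m x y : ℕ) (hp : Nat.Prime p) (hop : Odd p) (hm : 1 ≤ m)
    (hcop : Nat.gcd x y = 1) (heq : x ^ 2 + p ^ (2 * m) = 2 * y ^ p) :
    ∃ z : GaussianInt, (⟨x, (p : ℤ) ^ m⟩ : GaussianInt) = ⟨1, 1⟩ * z ^ p ∧ z.norm = y ∧ Odd y ∧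
      p ^ 2 ≤ 2 * y ∧ (p ^ m) ^ 2 ≤ p ^ 2 * (2 * y) := by
  obtain ⟨z, hz, hn, hyo⟩ := gauss_root p m x y hp hop hm hcop heq
  refine ⟨z, hz, hn, hyo, ?_⟩
  have hI : (⟨0, 1⟩ : GaussianInt) ^ 4 = 1 := by decide
  obtain ⟨ε, B, g, hε, hB1, hB2, hg, hB3⟩ : ∃ (ε : GaussianInt) (B : ℤ) (g : GaussianInt),
      ε ^ p = ⟨0, 1⟩ ∧ z + ε * star z = g * B ∧ B ^ 2 ≤ 2 * y ∧
      (∃ g', IsUnit g' ∧ ⟨1, 1⟩ * g = 2 * g') ∧ ε.norm = 1 := by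
    rw [Zsqrtd.norm_def] at hn
    have h4 : p % 4 = 1 ∨ p % 4 = 3 := by
      obtain ⟨k, hk⟩ := hop; omega
    rcases h4 with h4 | h4
    · refine ⟨⟨0, 1⟩, z.re + z.im, ⟨1, 1⟩, ?_, ?_, ?_, ⟨⟨0, 1⟩, ?_, ?_⟩, ?_⟩
      · have : p = 4 * (p / 4) + 1 := by omega
        rw [this, pow_add, pow_mul, hI]; simp
      · ext <;> simp <;> ring
      · nlinarith [sq_nonneg (z.re - z.im)]
      · exact (Zsqrtd.norm_eq_one_iff' (by norm_num) _).1 (by decide)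
      · decide
      · decide
    · refine ⟨⟨0, -1⟩, z.re - z.im, ⟨1, -1⟩, ?_, ?_, ?_, ⟨1, ?_, ?_⟩, ?_⟩
      · have : p = 4 * (p / 4) + 3 := by omega
        rw [this, pow_add, pow_mul]
        have : (⟨0, -1⟩ : GaussianInt) ^ 4 = 1 := by decide
        rw [this]
        simp
        decide
      · ext <;> simp <;> ring
      · nlinarith [sq_nonneg (z.re + z.im)]
      · exact isUnit_one
      · decide
      · decide
  obtain ⟨g', hgu, hgg⟩ := hg
  set a : GaussianInt := -(ε * star z) with ha
  have hapow : a ^ p = -(⟨0, 1⟩ * star z ^ p) := by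
    rw [ha, hop.neg_pow, mul_pow, hε]
  have hmain : (⟨0, 2⟩ : GaussianInt) * (p : GaussianInt) ^ m = ⟨1, 1⟩ * (z ^ p - a ^ p) := by
    have h1 : star (⟨x, (p : ℤ) ^ m⟩ : GaussianInt) = ⟨1, -1⟩ * star z ^ p := by
      rw [hz, star_mul, star_pow, mul_comm]; rfl
    have h2 : (⟨0, 2⟩ : GaussianInt) * (p : GaussianInt) ^ m =
        (⟨x, (p : ℤ) ^ m⟩ : GaussianInt) - star (⟨x, (p : ℤ) ^ m⟩ : GaussianInt) := by
      have : ((p : GaussianInt)) ^ m = (((p : ℤ) ^ m : ℤ) : GaussianInt) := by push_cast; rfl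
      rw [this]
      generalize (p : ℤ) ^ m = P
      ext <;> simp
      ring
    rw [h2, h1, hz, hapow, mul_sub, mul_neg, sub_neg_eq_add, ← mul_assoc,
      sub_eq_add_neg, ← neg_mul]
    congr 1
  set Q : GaussianInt := ∑ i ∈ Finset.range p, z ^ i * a ^ (p - 1 - i) with hQ
  have hQ2 : Q * (z - a) = z ^ p - a ^ p := (Commute.all z a).geom_sum₂_mul p
  have hza : z - a = g * B := by rw [ha, sub_neg_eq_add, hB1]
  have hfac : (⟨0, 1⟩ : GaussianInt) * (p : GaussianInt) ^ m = g' * B * Q := by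
    have h2 : (2 : GaussianInt) ≠ 0 := by norm_num
    apply mul_left_cancel₀ h2
    have h3 : (2 : GaussianInt) * ⟨0, 1⟩ = ⟨0, 2⟩ := by decide
    rw [← mul_assoc, h3, hmain, ← hQ2, hza]
    linear_combination (B * Q : GaussianInt) * hgg
  have hpB : (p : ℤ) ∣ B := by
    obtain ⟨r, hr⟩ := exists_add_pow_prime_eq hp z (-a)
    have h1 : (p : GaussianInt) ∣ ⟨1, 1⟩ * (z + -a) ^ p := by
      rw [hr, hop.neg_pow, ← sub_eq_add_neg, mul_add, ← hmain]
      apply dvd_add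
      · exact Dvd.dvd.mul_left (dvd_pow_self _ (by omega)) _
      · exact ⟨⟨1, 1⟩ * (z * -a * r), by ring⟩
    have h2 : (p : GaussianInt) ∣ (2 * B * g') ^ p := by
      have : (2 * B * g' : GaussianInt) = ⟨1, 1⟩ * (z + -a) := by
        rw [← sub_eq_add_neg, hza, ← mul_assoc, hgg]; ring
      rw [this, mul_pow]
      obtain ⟨n, hn⟩ : ∃ n, p = n + 1 := ⟨p - 1, by have := hp.pos; omega⟩
      have h3 : (⟨1, 1⟩ : GaussianInt) ^ p = ⟨1, 1⟩ ^ n * ⟨1, 1⟩ := by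
        conv_lhs => rw [hn, pow_succ]
      rw [h3, mul_assoc]
      exact Dvd.dvd.mul_left h1 _
    rw [mul_pow] at h2
    have h3 := ((hgu.pow p).dvd_mul_right).1 h2
    have h4 : ((p : ℤ) : GaussianInt) ∣ (((2 * B) ^ p : ℤ) : GaussianInt) := by
      push_cast; exact h3
    rw [Zsqrtd.intCast_dvd_intCast] at h4
    have hpp : Prime (p : ℤ) := Nat.prime_iff_prime_int.1 hp
    have h5 := hpp.dvd_of_dvd_pow h4
    rcases hpp.dvd_or_dvd h5 with h6 | h6
    · exfalso
      have : p ∣ 2 := by exact_mod_cast h6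
      have := (Nat.prime_dvd_prime_iff_eq hp Nat.prime_two).1 this
      subst this
      exact absurd hop (by decide)
    · exact h6
  have hBp : B ∣ (p : ℤ) ^ m := by
    have h1 : (B : GaussianInt) ∣ (((p : ℤ) ^ m : ℤ) : GaussianInt) := by
      refine ⟨⟨0, -1⟩ * (g' * Q), ?_⟩
      have h2 : (⟨0, -1⟩ : GaussianInt) * ⟨0, 1⟩ = 1 := by decide
      push_cast
      calc (p : GaussianInt) ^ m = ⟨0, -1⟩ * ⟨0, 1⟩ * (p : GaussianInt) ^ m := by rw [h2, one_mul]
        _ = _ := by rw [mul_assoc, hfac]; ring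
    exact (Zsqrtd.intCast_dvd_intCast _ _).1 h1
  have hBn : B.natAbs ∣ p ^ m := by
    have := Int.natAbs_dvd_natAbs.2 hBp
    simpa [Int.natAbs_pow] using this
  obtain ⟨k, hkm, hk⟩ := (Nat.dvd_prime_pow hp).1 hBn
  have hB2' : B.natAbs ^ 2 ≤ 2 * y := by
    zify; simpa using hB2
  have hpB' : p ∣ B.natAbs := Int.natCast_dvd.1 hpB
  have hB0 : 0 < B.natAbs := by rw [hk]; exact pow_pos hp.pos _
  have hple : p ≤ B.natAbs := Nat.le_of_dvd hB0 hpB'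
  refine ⟨(Nat.pow_le_pow_left hple 2).trans hB2', ?_⟩
  have hkm1 : m ≤ k + 1 := by
    by_contra hlt
    push Not at hlt
    have hp2Q : (p : GaussianInt) ^ 2 ∣ Q := by
      obtain ⟨j, hj⟩ : ∃ j, m = k + 2 + j := ⟨m - (k + 2), by omega⟩
      have h1 : (B : GaussianInt) = (p : GaussianInt) ^ k ∨ (B : GaussianInt) = -(p : GaussianInt) ^ k := by
        rcases Int.natAbs_eq B with h | h
        · left; rw [h, hk]; push_cast; rfl
        · right; rw [h, hk]; push_cast; rfl
      have hpk : (p : GaussianInt) ^ k ≠ 0 := pow_ne_zero _ (by exact_mod_cast hp.ne_zero)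
      have h2 : (p : GaussianInt) ^ 2 ∣ g' * Q := by
        rcases h1 with h1 | h1
        · refine ⟨⟨0, 1⟩ * (p : GaussianInt) ^ j, ?_⟩
          apply mul_left_cancel₀ hpk
          rw [h1, hj] at hfac
          linear_combination -hfac
        · refine ⟨-(⟨0, 1⟩ * (p : GaussianInt) ^ j), ?_⟩
          apply mul_left_cancel₀ hpk
          rw [h1, hj] at hfac
          linear_combination hfac
      exact (hgu.dvd_mul_left).1 h2
    obtain ⟨b, hb⟩ := hpB
    have hz2 : z = a + p * (g * b) := by
      have : (B : GaussianInt) = p * b := by rw [hb]; push_cast; rfl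
      rw [this] at hza
      linear_combination hza
    have h3 := odd_sq_dvd_geom_sum₂_sub a (g * b : GaussianInt) hop
    rw [← hz2] at h3
    have h4 : (p : GaussianInt) ^ 2 ∣ p * a ^ (p - 1) := by
      have := dvd_sub hp2Q h3
      simpa [hQ] using this
    rw [pow_two] at h4
    have h5 := (mul_dvd_mul_iff_left (by exact_mod_cast hp.ne_zero : (p : GaussianInt) ≠ 0)).1 h4
    have h6 : (p : ℤ) ∣ (y : ℤ) := by
      have h7 := map_dvd (Zsqrtd.normMonoidHom (d := -1)) h5
      rw [map_pow] at h7
      have h8 : Zsqrtd.normMonoidHom (d := -1) a = y := by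
        change Zsqrtd.norm a = y
        rw [ha, Zsqrtd.norm_neg, Zsqrtd.norm_mul, hB3, Zsqrtd.norm_conj, hn, one_mul]
      have h9 : Zsqrtd.normMonoidHom (d := -1) (p : GaussianInt) = (p : ℤ) * p := by
        change Zsqrtd.norm (p : GaussianInt) = (p : ℤ) * p
        rw [Zsqrtd.norm_natCast]
      rw [h8, h9] at h7
      exact (Nat.prime_iff_prime_int.1 hp).dvd_of_dvd_pow (dvd_of_mul_left_dvd h7)
    have h7 : p ∣ y := by exact_mod_cast h6
    have h8 : p ∣ x ^ 2 := by
      have h9 : p ∣ x ^ 2 + p ^ (2 * m) := by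
        rw [heq]; exact Dvd.dvd.mul_left (dvd_pow h7 hp.ne_zero) _
      exact (Nat.dvd_add_left (dvd_pow_self p (by omega))).1 h9
    have h9 := hp.dvd_of_dvd_pow h8
    have := Nat.dvd_gcd h9 h7
    rw [hcop] at this
    exact hp.one_lt.ne' (Nat.dvd_one.1 this)
  calc (p ^ m) ^ 2 ≤ (p ^ (k + 1)) ^ 2 :=
        Nat.pow_le_pow_left (Nat.pow_le_pow_right hp.pos hkm1) 2
    _ = p ^ 2 * B.natAbs ^ 2 := by rw [hk]; ring
    _ ≤ _ := Nat.mul_le_mul_left _ hB2'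

end CPart

section D1Part

open Polynomial

/-- majorant of a complex polynomial -/
noncomputable def maj (f : ℂ[X]) (r : ℝ) : ℝ := f.sum (fun m a => ‖a‖ * r ^ m)

lemma maj_eq (f : ℂ[X]) (r : ℝ) (D : ℕ) (hD : f.natDegree < D) :
    maj f r = ∑ m : Fin D, ‖f.coeff m‖ * r ^ (m : ℕ) := by
  unfold maj
  rw [sum_over_range' f (by simp) D hD]
  exact (Fin.sum_univ_eq_sum_range (fun m => ‖f.coeff m‖ * r ^ m) D).symm

lemma maj_eq_range (f : ℂ[X]) (r : ℝ) (D : ℕ) (hD : f.natDegree < D) :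
    maj f r = ∑ m ∈ Finset.range D, ‖f.coeff m‖ * r ^ m := by
  unfold maj
  rw [sum_over_range' f (by simp) D hD]

lemma maj_nonneg (f : ℂ[X]) {r : ℝ} (hr : 0 ≤ r) : 0 ≤ maj f r := by
  unfold maj Polynomial.sum
  positivity

lemma maj_add_le (f g : ℂ[X]) {r : ℝ} (hr : 0 ≤ r) : maj (f + g) r ≤ maj f r + maj g r := by
  set D := max f.natDegree g.natDegree + 1 with hD
  rw [maj_eq_range (f + g) r D (by have := natDegree_add_le f g; omega),
    maj_eq_range f r D (by omega), maj_eq_range g r D (by omega), ← Finset.sum_add_distrib]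
  apply Finset.sum_le_sum
  intro m _
  rw [coeff_add, ← add_mul]
  gcongr
  exact norm_add_le _ _

lemma maj_sum_le {ι : Type*} (s : Finset ι) (f : ι → ℂ[X]) {r : ℝ} (hr : 0 ≤ r) :
    maj (∑ i ∈ s, f i) r ≤ ∑ i ∈ s, maj (f i) r := by
  classical
  induction s using Finset.induction_on with
  | empty => simp [maj]
  | insert a s ha ih =>
    rw [Finset.sum_insert ha, Finset.sum_insert ha]
    exact (maj_add_le _ _ hr).trans (by linarith)

lemma maj_monomial (n : ℕ) (a : ℂ) (r : ℝ) : maj (monomial n a) r = ‖a‖ * r ^ n := by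
  unfold maj
  rw [sum_monomial_index]
  simp

lemma maj_mul_le (f g : ℂ[X]) {r : ℝ} (hr : 0 ≤ r) : maj (f * g) r ≤ maj f r * maj g r := by
  conv_lhs => rw [f.as_sum_support, g.as_sum_support, Finset.sum_mul_sum]
  refine (maj_sum_le _ _ hr).trans ?_
  conv_rhs => unfold maj Polynomial.sum
  rw [Finset.sum_mul_sum]
  apply Finset.sum_le_sum
  intro i _
  refine (maj_sum_le _ _ hr).trans ?_
  apply Finset.sum_le_sum
  intro j _
  rw [monomial_mul_monomial, maj_monomial, norm_mul, pow_add]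
  apply le_of_eq
  ring

lemma norm_eval_le_maj (f : ℂ[X]) (x : ℂ) {r : ℝ} (hx : ‖x‖ ≤ r) : ‖f.eval x‖ ≤ maj f r := by
  rw [eval_eq_sum]
  unfold maj Polynomial.sum
  refine (norm_sum_le _ _).trans ?_
  apply Finset.sum_le_sum
  intro m _
  rw [norm_mul, norm_pow]
  exact mul_le_mul_of_nonneg_left (pow_le_pow_left₀ (norm_nonneg _) hx m) (norm_nonneg _)

/-- binomial polynomial -/
noncomputable def binP (k : ℕ) : ℂ[X] := C ((k.factorial : ℂ)⁻¹) * descPochhammer ℂ k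

lemma binP_degree (k : ℕ) : (binP k).degree = k := by
  unfold binP
  have h : ((k.factorial : ℂ)⁻¹) ≠ 0 := inv_ne_zero (by exact_mod_cast k.factorial_ne_zero)
  rw [degree_C_mul h, degree_eq_natDegree (monic_descPochhammer ℂ k).ne_zero,
    descPochhammer_natDegree]

lemma binP_natDegree (k : ℕ) : (binP k).natDegree = k :=
  natDegree_eq_of_degree_eq_some (binP_degree k)

lemma binP_li (K : ℕ) : LinearIndependent ℂ (fun k : Fin K => binP k) := by
  let S : Polynomial.Sequence ℂ := ⟨binP, binP_degree⟩
  exact S.linearIndependent.comp (fun k : Fin K => (k : ℕ)) Fin.val_injective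

lemma binP_int (k : ℕ) (x : ℤ) : ∃ n : ℤ, (binP k).eval (x : ℂ) = n := by
  refine ⟨Ring.choose x k, ?_⟩
  have h1 := Ring.descPochhammer_eq_factorial_smul_choose x k
  rw [← eval_eq_smeval] at h1
  have h2 : (descPochhammer ℂ k).eval (x : ℂ) = (((descPochhammer ℤ k).eval x : ℤ) : ℂ) := by
    rw [← descPochhammer_map (Int.castRingHom ℂ) k]
    rw [← eq_intCast (Int.castRingHom ℂ) x, eval_map_apply]
    simp
  unfold binP
  rw [eval_mul, eval_C, h2, h1]
  have h : (k.factorial : ℂ) ≠ 0 := by exact_mod_cast k.factorial_ne_zero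
  simp
  field_simp

lemma maj_descPochhammer (k K : ℕ) (hk : k ≤ K) {r : ℝ} (hr : 0 ≤ r) :
    maj (descPochhammer ℂ k) r ≤ (r + K) ^ k := by
  induction k with
  | zero =>
    rw [descPochhammer_zero, ← monomial_zero_one, maj_monomial]; simp
  | succ n ih =>
    rw [descPochhammer_succ_right, pow_succ]
    refine (maj_mul_le _ _ hr).trans ?_
    have h1 := ih (by omega)
    have h2 : maj (X - (n : ℂ[X])) r ≤ r + K := by
      have : (X - (n : ℂ[X])) = monomial 1 1 + monomial 0 (-(n : ℂ)) := by
        rw [monomial_zero_left, monomial_one_one_eq_X]; simp [sub_eq_add_neg]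
      rw [this]
      refine (maj_add_le _ _ hr).trans ?_
      rw [maj_monomial, maj_monomial]
      simp
      omega
    have h3 := maj_nonneg (descPochhammer ℂ n) hr
    have h4 := maj_nonneg (X - (n : ℂ[X])) hr
    gcongr

lemma maj_binP (k K : ℕ) (hk : k ≤ K) {r : ℝ} (hr : 0 ≤ r) :
    maj (binP k) r ≤ 4096 ^ k * Real.exp ((r + K) / 4096) := by
  unfold binP
  refine (maj_mul_le _ _ hr).trans ?_
  rw [← monomial_zero_left, maj_monomial]
  have h1 := maj_descPochhammer k K hk hr
  have h2 := Real.pow_div_factorial_le_exp ((r + K) / 4096) (by positivity) k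
  have h3 : (0 : ℝ) < k.factorial := by exact_mod_cast k.factorial_pos
  simp only [norm_inv, Complex.norm_natCast, pow_zero, mul_one]
  calc (k.factorial : ℝ)⁻¹ * maj (descPochhammer ℂ k) r ≤ (k.factorial : ℝ)⁻¹ * (r + K) ^ k := by
        gcongr
    _ = 4096 ^ k * (((r + K) / 4096) ^ k / k.factorial) := by
        rw [div_pow]; field_simp
    _ ≤ _ := by gcongr

/-- Taylor polynomial of `exp (c x)` -/
noncomputable def expT (c : ℂ) (n : ℕ) : ℂ[X] :=
  ∑ m ∈ Finset.range n, monomial m (c ^ m / m.factorial)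

lemma expT_natDegree (c : ℂ) (n : ℕ) : (expT c n).natDegree ≤ n := by
  apply natDegree_sum_le_of_forall_le
  intro m hm
  exact (natDegree_monomial_le _).trans (Finset.mem_range.1 hm).le

lemma maj_expT (c : ℂ) (n : ℕ) {r : ℝ} (hr : 0 ≤ r) : maj (expT c n) r ≤ Real.exp (‖c‖ * r) := by
  refine (maj_sum_le _ _ hr).trans ?_
  refine le_trans (le_of_eq ?_) (Real.sum_le_exp_of_nonneg (x := ‖c‖ * r) (by positivity) n)
  apply Finset.sum_congr rfl
  intro m _
  rw [maj_monomial, norm_div, norm_pow, mul_pow]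
  simp
  ring

lemma expT_tail (c x : ℂ) (n : ℕ) {ρ : ℝ} (hρ : 1 ≤ ρ) :
    ‖Complex.exp (c * x) - (expT c n).eval x‖ ≤ Real.exp (ρ * (‖c‖ * ‖x‖)) / ρ ^ n := by
  have hρ0 : 0 < ρ := by linarith
  set w := c * x with hw
  have h1 : (expT c n).eval x = ∑ m ∈ Finset.range n, w ^ m / m.factorial := by
    unfold expT
    rw [eval_finsetSum]
    apply Finset.sum_congr rfl
    intro m _
    rw [eval_monomial, hw, mul_pow]; ring
  rw [h1]
  refine (Complex.norm_exp_sub_sum_le_exp_norm_sub_sum w n).trans ?_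
  rw [← norm_mul, ← hw]
  have hs := Real.summable_pow_div_factorial ‖w‖
  have hs2 := Real.summable_pow_div_factorial (ρ * ‖w‖)
  have e1 : Real.exp ‖w‖ = ∑' m : ℕ, ‖w‖ ^ m / m.factorial := by
    rw [Real.exp_eq_exp_ℝ, NormedSpace.exp_eq_tsum_div]
  have e2 : Real.exp (ρ * ‖w‖) = ∑' m : ℕ, (ρ * ‖w‖) ^ m / m.factorial := by
    rw [Real.exp_eq_exp_ℝ, NormedSpace.exp_eq_tsum_div]
  rw [e1, e2, ← hs.sum_add_tsum_nat_add n, ← hs2.sum_add_tsum_nat_add n, add_sub_cancel_left,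
    le_div_iff₀ (by positivity), mul_comm, ← tsum_mul_left]
  refine le_trans (Summable.tsum_le_tsum (g := fun i => (ρ * ‖w‖) ^ (i + n) / ((i + n).factorial : ℝ))
    ?_ ?_ ?_) (le_add_of_nonneg_left (by positivity))
  · intro i
    rw [mul_pow, mul_div_assoc]
    have : ρ ^ n ≤ ρ ^ (i + n) := pow_le_pow_right₀ hρ (by omega)
    gcongr
  · exact ((summable_nat_add_iff n).2 hs).mul_left _
  · exact (summable_nat_add_iff n).2 hs2

end D1Part

section D2Part

lemma linear_form (p m x y h : ℕ) (hx : 0 < x) (hy : 0 < y) (hp0 : 0 < p) (hph : p = 2 * h + 1)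
    (z : GaussianInt)
    (hz : (⟨x, (p : ℤ) ^ m⟩ : GaussianInt) = ⟨1, 1⟩ * z ^ p) (hn : z.norm = y)
    (hpm : (p ^ m) ^ 2 ≤ p ^ 2 * (2 * y)) :
    ∃ (ω lam : ℝ) (b : ℤ), GaussianInt.toComplex z = Complex.exp (ω * Complex.I) *
        (starRingEnd ℂ) (GaussianInt.toComplex z) ∧
      p * ω = Real.pi / 2 * b + lam ∧ 0 < lam ∧ lam ≤ Real.pi * p / y ^ h ∧ Odd b := by
  set Z := GaussianInt.toComplex z with hZ
  have hZn : ‖Z‖ ^ 2 = y := by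
    rw [← Complex.normSq_eq_norm_sq, ← GaussianInt.intCast_real_norm, hn]; simp
  have hy' : (0 : ℝ) < y := by exact_mod_cast hy
  have hZ0 : Z ≠ 0 := by
    intro h0; rw [h0] at hZn; simp at hZn; linarith
  have hZpos : 0 < ‖Z‖ := norm_pos_iff.2 hZ0
  set W : ℂ := x + (p : ℂ) ^ m * Complex.I with hW
  have hWZ : W = (1 + Complex.I) * Z ^ p := by
    have := congrArg GaussianInt.toComplex hz
    rw [map_mul, map_pow, ← hZ, GaussianInt.toComplex_def', GaussianInt.toComplex_def'] at this
    push_cast at this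
    rw [hW, this]; ring
  have hWre : W.re = x := by
    have : W = ⟨(x : ℝ), (p : ℝ) ^ m⟩ := by
      rw [hW]; apply Complex.ext <;> simp [← Complex.ofReal_natCast, ← Complex.ofReal_pow]
    rw [this]
  have hWim : W.im = (p : ℝ) ^ m := by
    have : W = ⟨(x : ℝ), (p : ℝ) ^ m⟩ := by
      rw [hW]; apply Complex.ext <;> simp [← Complex.ofReal_natCast, ← Complex.ofReal_pow]
    rw [this]
  have hx' : (0 : ℝ) < x := by exact_mod_cast hx
  have hpp : (0 : ℝ) < p := by exact_mod_cast hp0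
  have hW0 : W ≠ 0 := by
    intro h0; rw [h0] at hWre; simp at hWre; linarith
  have hWpos : 0 < ‖W‖ := norm_pos_iff.2 hW0
  set φ := W.arg with hφ
  have hφ0 : 0 ≤ φ := by
    rw [hφ, Complex.arg_nonneg_iff, hWim]; positivity
  have hφ1 : φ ≤ Real.pi / 2 := by
    have : |W.arg| ≤ Real.pi / 2 := Complex.abs_arg_le_pi_div_two_iff.2 (by rw [hWre]; positivity)
    exact (le_abs_self _).trans this
  have hsin : Real.sin φ = (p : ℝ) ^ m / ‖W‖ := by rw [hφ, Complex.sin_arg, hWim]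
  have hsinpos : 0 < Real.sin φ := by rw [hsin]; positivity
  have hφpos : 0 < φ := by
    rcases hφ0.lt_or_eq with h1 | h1
    · exact h1
    · rw [← h1] at hsinpos; simp at hsinpos
  have hWn : ‖W‖ = Real.sqrt 2 * ‖Z‖ ^ p := by
    rw [hWZ, norm_mul, norm_pow]
    congr 1
    rw [Complex.norm_def]
    congr 1
    simp [Complex.normSq_apply]; norm_num
  have hargs : Complex.exp (φ * Complex.I) =
      Complex.exp ((Real.pi / 4 + p * Z.arg : ℝ) * Complex.I) := by
    have h1 : (‖W‖ : ℂ) * Complex.exp (φ * Complex.I) = W := Complex.norm_mul_exp_arg_mul_I W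
    have h2 : (‖Z‖ : ℂ) * Complex.exp (Z.arg * Complex.I) = Z := Complex.norm_mul_exp_arg_mul_I Z
    have h3 : (Real.sqrt 2 : ℂ) * Complex.exp ((Real.pi / 4 : ℝ) * Complex.I) = 1 + Complex.I := by
      rw [Complex.exp_mul_I, ← Complex.ofReal_cos, ← Complex.ofReal_sin, Real.cos_pi_div_four,
        Real.sin_pi_div_four]
      have : (Real.sqrt 2 : ℂ) * (Real.sqrt 2 : ℂ) = 2 := by
        rw [← Complex.ofReal_mul, Real.mul_self_sqrt (by norm_num)]; simp
      push_cast
      linear_combination ((1 + Complex.I) / 2) * this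
    have h4 : (‖W‖ : ℂ) ≠ 0 := by exact_mod_cast hWpos.ne'
    apply mul_left_cancel₀ h4
    rw [h1, hWn, hWZ]
    conv_lhs => rw [← h2, ← h3]
    rw [mul_pow, ← Complex.exp_nat_mul]
    push_cast
    rw [add_mul, Complex.exp_add]
    ring_nf
  obtain ⟨n, hn2⟩ := Complex.exp_eq_exp_iff_exists_int.1 hargs
  have hn3 : φ = Real.pi / 4 + p * Z.arg + n * (2 * Real.pi) := by
    have h1 := congrArg Complex.im hn2
    simpa using h1
  refine ⟨2 * Z.arg, 2 * φ, -1 - 8 * n, ?_, ?_, by linarith, ?_, ?_⟩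
  · have h2 : (‖Z‖ : ℂ) * Complex.exp (Z.arg * Complex.I) = Z := Complex.norm_mul_exp_arg_mul_I Z
    have h3 : (starRingEnd ℂ) Z = ‖Z‖ * Complex.exp (-(Z.arg * Complex.I)) := by
      conv_lhs => rw [← h2]
      rw [map_mul, ← Complex.exp_conj]
      simp
    rw [h3]
    conv_lhs => rw [← h2]
    rw [mul_left_comm, ← Complex.exp_add]
    congr 2
    push_cast; ring
  · push_cast
    rw [hn3]; ring
  · have h1 := Real.mul_le_sin hφ0 hφ1
    rw [hsin] at h1
    have h2 : (p : ℝ) ^ m / ‖W‖ ≤ p / y ^ h := by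
      rw [div_le_div_iff₀ hWpos (by positivity)]
      apply le_of_sq_le_sq _ (by positivity)
      have h3 : ((p : ℝ) ^ m) ^ 2 ≤ p ^ 2 * (2 * y) := by exact_mod_cast hpm
      have h6 : (‖Z‖ ^ p) ^ 2 = (y : ℝ) ^ (2 * h) * y := by
        rw [← pow_mul, mul_comm p 2, pow_mul, hZn, hph, pow_succ]
      have h5 : (0 : ℝ) ≤ (y : ℝ) ^ (2 * h) := by positivity
      calc ((p : ℝ) ^ m * (y : ℝ) ^ h) ^ 2 = ((p : ℝ) ^ m) ^ 2 * (y : ℝ) ^ (2 * h) := by ring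
        _ ≤ (p ^ 2 * (2 * y)) * (y : ℝ) ^ (2 * h) := by gcongr
        _ = (p * ‖W‖) ^ 2 := by
            rw [hWn, mul_pow, mul_pow, Real.sq_sqrt (by norm_num), h6]; ring
    have hpi := Real.pi_pos
    have h3 : 2 / Real.pi * φ ≤ p / y ^ h := h1.trans h2
    have h4 : 2 * φ = Real.pi * (2 / Real.pi * φ) := by field_simp
    rw [h4, mul_div_assoc]
    gcongr
  · exact ⟨-1 - 4 * n, by ring⟩

lemma not_dvd_b (p y h : ℕ) (hp : Odd p) (hh : 1 ≤ h) (hy16 : 16 ≤ y) (hyo : Odd y)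
    (z : GaussianInt) (hn : z.norm = y)
    (ω lam : ℝ) (b : ℤ) (h1 : GaussianInt.toComplex z = Complex.exp (ω * Complex.I) *
        (starRingEnd ℂ) (GaussianInt.toComplex z))
    (h2 : p * ω = Real.pi / 2 * b + lam) (h3 : 0 < lam) (h4 : lam ≤ Real.pi * p / y ^ h)
    (h5 : Odd b) : ¬ (p : ℤ) ∣ b := by
  rintro ⟨c, rfl⟩
  have hc : Odd c := (Int.odd_mul.1 h5).2
  have hp0 : (0 : ℝ) < p := by exact_mod_cast hp.pos
  have hy' : (16 : ℝ) ≤ y := by exact_mod_cast hy16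
  have hω : ω = Real.pi / 2 * c + lam / p := by
    field_simp
    push_cast at h2
    linarith
  set Z := GaussianInt.toComplex z with hZ
  have hZn : ‖Z‖ ^ 2 = y := by
    rw [← Complex.normSq_eq_norm_sq, ← GaussianInt.intCast_real_norm, hn]; simp
  set d : ℂ := Complex.exp ((Real.pi / 2 * c : ℝ) * Complex.I) with hd
  have hdn : ‖d‖ = 1 := Complex.norm_exp_ofReal_mul_I _
  have hdI : d = Complex.I ∨ d = -Complex.I := by
    obtain ⟨n, hn⟩ := hc
    have : d = Complex.exp (Real.pi / 2 * Complex.I) * (Complex.exp (Real.pi * Complex.I)) ^ n := by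
      rw [← Complex.exp_int_mul, ← Complex.exp_add, hd, hn]
      congr 1
      push_cast; ring
    rw [Complex.exp_pi_div_two_mul_I, Complex.exp_pi_mul_I] at this
    rcases Int.even_or_odd n with hne | hno
    · left; rw [this, hne.neg_one_zpow, mul_one]
    · right; rw [this, hno.neg_one_zpow]; ring
  have hdiff : Z - d * (starRingEnd ℂ) Z =
      d * (starRingEnd ℂ) Z * (Complex.exp (Complex.I * (lam / p : ℝ)) - 1) := by
    have he : Complex.exp (ω * Complex.I) = d * Complex.exp (Complex.I * (lam / p : ℝ)) := by
      rw [hd, ← Complex.exp_add, hω]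
      congr 1
      push_cast; ring
    rw [he] at h1
    linear_combination h1
  have hle : ‖Z - d * (starRingEnd ℂ) Z‖ ≤ ‖Z‖ * (lam / p) := by
    rw [hdiff, norm_mul, norm_mul, hdn, one_mul, RCLike.norm_conj]
    gcongr
    refine (Real.norm_exp_I_mul_ofReal_sub_one_le).trans ?_
    rw [Real.norm_of_nonneg (by positivity)]
  have hre : 1 ≤ ‖Z - d * (starRingEnd ℂ) Z‖ := by
    refine le_trans ?_ (Complex.abs_re_le_norm _)
    have hodd : Odd (z.re * z.re + z.im * z.im) := by
      rw [Zsqrtd.norm_def] at hn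
      have : z.re * z.re + z.im * z.im = y := by linarith
      rw [this]; exact_mod_cast hyo
    have hZre : Z.re = z.re := by rw [hZ, ← GaussianInt.intCast_re]
    have hZim : Z.im = z.im := by rw [hZ, ← GaussianInt.intCast_im]
    have hpar : Odd (z.re - z.im) ∧ Odd (z.re + z.im) := by
      simp only [Int.odd_add, Int.odd_sub, Int.odd_mul, Int.even_mul] at hodd ⊢
      tauto
    rcases hdI with h | h
    · have : (Z - d * (starRingEnd ℂ) Z).re = ((z.re - z.im : ℤ) : ℝ) := by
        rw [h]; simp [hZre, hZim]
      rw [this]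
      have h0 : (z.re - z.im) ≠ 0 := by rintro h0; rw [h0] at hpar; exact absurd hpar.1 (by decide)
      exact_mod_cast Int.one_le_abs h0
    · have : (Z - d * (starRingEnd ℂ) Z).re = ((z.re + z.im : ℤ) : ℝ) := by
        rw [h]; simp [hZre, hZim]
      rw [this]
      have h0 : (z.re + z.im) ≠ 0 := by rintro h0; rw [h0] at hpar; exact absurd hpar.2 (by decide)
      exact_mod_cast Int.one_le_abs h0
  have hlp : lam / p ≤ Real.pi / y := by
    rw [div_le_div_iff₀ hp0 (by positivity)]
    have : lam ≤ Real.pi * p / y := by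
      refine h4.trans ?_
      have : (y : ℝ) ≤ y ^ h := le_self_pow₀ (by linarith) (by omega)
      have := Real.pi_pos
      gcongr
    rwa [le_div_iff₀ (by positivity)] at this
  have hZ4 : 4 ≤ ‖Z‖ := by nlinarith [norm_nonneg Z]
  have : ‖Z‖ * (lam / p) ≤ ‖Z‖ * (Real.pi / y) := by gcongr
  have h6 : ‖Z‖ * (Real.pi / y) = Real.pi / ‖Z‖ := by
    rw [← hZn]; field_simp
  have h7 : Real.pi / ‖Z‖ < 1 := by
    rw [div_lt_one (by linarith)]
    have := Real.pi_lt_four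
    linarith
  linarith

end D2Part

section E1Part

lemma gauss_I_zpow (k : ℤ) : ∃ g : GaussianInt, GaussianInt.toComplex g = Complex.I ^ k := by
  obtain ⟨n, rfl | rfl⟩ := k.eq_nat_or_neg
  · refine ⟨⟨0, 1⟩ ^ n, ?_⟩
    rw [map_pow, GaussianInt.toComplex_def', zpow_natCast]; simp
  · refine ⟨⟨0, -1⟩ ^ n, ?_⟩
    rw [map_pow, GaussianInt.toComplex_def', zpow_neg, zpow_natCast, ← inv_pow, Complex.inv_I]
    simp

lemma gauss_E_zpow (y : ℕ) (z : GaussianInt) (hn : z.norm = y) (E : ℂ) (hE : E ≠ 0)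
    (h1 : GaussianInt.toComplex z = E * (starRingEnd ℂ) (GaussianInt.toComplex z))
    (n : ℕ) (e : ℤ) (he : e.natAbs ≤ n) :
    ∃ g : GaussianInt, GaussianInt.toComplex g = (y : ℂ) ^ n * E ^ e := by
  set Z := GaussianInt.toComplex z with hZ
  have hy : (y : ℂ) = Z * (starRingEnd ℂ) Z := by
    rw [Complex.mul_conj, ← GaussianInt.intCast_complex_norm, hn]; simp
  have h2 : (y : ℂ) * E = Z ^ 2 := by
    rw [hy]; linear_combination (-Z) * h1
  have h3 : (y : ℂ) * E⁻¹ = ((starRingEnd ℂ) Z) ^ 2 := by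
    rw [hy]
    field_simp
    linear_combination ((starRingEnd ℂ) Z) * h1
  obtain ⟨k, rfl | rfl⟩ := e.eq_nat_or_neg
  · have hk : k ≤ n := by simpa using he
    refine ⟨(y : GaussianInt) ^ (n - k) * (z ^ 2) ^ k, ?_⟩
    rw [map_mul, map_pow, map_pow, map_pow, ← hZ, ← h2, map_natCast, zpow_natCast, mul_pow,
      ← mul_assoc, ← pow_add, Nat.sub_add_cancel hk]
  · have hk : k ≤ n := by simpa using he
    refine ⟨(y : GaussianInt) ^ (n - k) * ((star z) ^ 2) ^ k, ?_⟩
    rw [map_mul, map_pow, map_pow, map_pow, GaussianInt.toComplex_star, ← hZ, ← h3, map_natCast,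
      zpow_neg, zpow_natCast, mul_pow, ← mul_assoc, ← pow_add, Nat.sub_add_cancel hk, inv_pow]

lemma gauss_entry (y : ℕ) (z : GaussianInt) (hn : z.norm = y) (ω : ℝ)
    (h1 : GaussianInt.toComplex z = Complex.exp (ω * Complex.I) *
      (starRingEnd ℂ) (GaussianInt.toComplex z))
    (Rm : ℕ) (c r s : ℤ) (hr : r.natAbs ≤ Rm) :
    ∃ g : GaussianInt, GaussianInt.toComplex g = (y : ℂ) ^ (c.natAbs * Rm) *
      Complex.exp (Complex.I * (c * (ω * r + Real.pi / 2 * s) : ℝ)) := by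
  obtain ⟨g1, hg1⟩ := gauss_E_zpow y z hn _ (Complex.exp_ne_zero _) h1 (c.natAbs * Rm) (c * r)
    (by rw [Int.natAbs_mul]; exact Nat.mul_le_mul_left _ hr)
  obtain ⟨g2, hg2⟩ := gauss_I_zpow (c * s)
  refine ⟨g1 * g2, ?_⟩
  have hI : Complex.I ^ (c * s) = Complex.exp (((c * s : ℤ) : ℂ) * (Real.pi / 2 * Complex.I)) := by
    rw [Complex.exp_int_mul, Complex.exp_pi_div_two_mul_I]
  rw [map_mul, hg1, hg2, hI, mul_assoc, ← Complex.exp_int_mul, ← Complex.exp_add]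
  congr 2
  push_cast; ring

lemma gauss_norm_ge_one (g : GaussianInt) (hg : GaussianInt.toComplex g ≠ 0) :
    1 ≤ ‖GaussianInt.toComplex g‖ := by
  have h0 : g ≠ 0 := by rintro rfl; simp at hg
  have h1 : (1 : ℤ) ≤ g.norm := GaussianInt.norm_pos.2 h0
  have h2 : (1 : ℝ) ≤ ‖GaussianInt.toComplex g‖ ^ 2 := by
    rw [← Complex.normSq_eq_norm_sq, ← GaussianInt.intCast_real_norm]; exact_mod_cast h1
  nlinarith [norm_nonneg (GaussianInt.toComplex g)]

lemma det_lower {ι : Type*} [Fintype ι] [DecidableEq ι] (M : Matrix ι ι ℂ) (v : ι → ℝ)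
    (hv : ∀ i, 0 < v i)
    (h : ∀ i j, ∃ g : GaussianInt, GaussianInt.toComplex g = (v i : ℂ) * M i j)
    (hM : M.det ≠ 0) : 1 ≤ (∏ i, v i) * ‖M.det‖ := by
  choose G hG using h
  have h1 : GaussianInt.toComplex (Matrix.det (Matrix.of G)) = (∏ i, (v i : ℂ)) * M.det := by
    rw [← Matrix.det_mul_column, RingHom.map_det]
    congr 1
    ext i j
    simp [hG]
  have h2 := gauss_norm_ge_one (Matrix.det (Matrix.of G)) (by
    rw [h1]
    apply mul_ne_zero _ hM
    rw [Finset.prod_ne_zero_iff]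
    intro i _
    exact_mod_cast (hv i).ne')
  rw [h1, norm_mul, norm_prod] at h2
  have h3 : ∀ i, ‖(v i : ℂ)‖ = v i := fun i => by
    rw [Complex.norm_real, Real.norm_of_nonneg (hv i).le]
  simp only [h3] at h2
  exact h2

/-- representative points -/
def ptX (p b : ℤ) (S : ℕ) (r : ℤ) (j : ℕ) : ℤ := (r * b + p * S / 2) % p - p * S / 2 + p * j

def ptS (p b : ℤ) (S : ℕ) (r : ℤ) (j : ℕ) : ℤ := j - (r * b + p * S / 2) / p

lemma ptX_eq (p b : ℤ) (S : ℕ) (r : ℤ) (j : ℕ) : ptX p b S r j = r * b + ptS p b S r j * p := by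
  unfold ptX ptS
  have := Int.emod_add_mul_ediv (r * b + p * S / 2) p
  linear_combination this

lemma ptX_abs (p b : ℤ) (hp : 0 < p) (S : ℕ) (r : ℤ) (j : ℕ) (hj : j < S) :
    |2 * ptX p b S r j| ≤ p * S := by
  unfold ptX
  have h1 := Int.emod_nonneg (r * b + p * S / 2) hp.ne'
  have h2 := Int.emod_lt_of_pos (r * b + p * S / 2) hp
  set u := (r * b + p * S / 2) % p
  have h3 : 0 ≤ p * (j : ℤ) := by positivity
  have h4 : p * ((j : ℤ) + 1) ≤ p * S := by
    apply mul_le_mul_of_nonneg_left _ hp.le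
    exact_mod_cast hj
  have h5 : p * ((j : ℤ) + 1) = p * j + p := by ring
  rw [abs_le]
  constructor <;> omega

lemma ptX_inj (p : ℕ) (b : ℤ) (hp : p.Prime) (hb : ¬ (p : ℤ) ∣ b) (S R : ℕ) (hR : 2 * R + 1 ≤ p)
    (i i' : Fin (2 * R + 1)) (j j' : Fin S)
    (h : ptX p b S ((i : ℤ) - R) j = ptX p b S ((i' : ℤ) - R) j') : i = i' ∧ j = j' := by
  have hpp : Prime (p : ℤ) := Nat.prime_iff_prime_int.1 hp
  have hi : i = i' := by
    have h1 := h
    rw [ptX_eq, ptX_eq] at h1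
    have h2 : (p : ℤ) ∣ ((i : ℤ) - i') * b := by
      refine ⟨ptS p b S ((i' : ℤ) - R) j' - ptS p b S ((i : ℤ) - R) j, ?_⟩
      linear_combination h1
    have h3 := (hpp.dvd_or_dvd h2).resolve_right hb
    have h4 : ((i : ℤ) - i') = 0 := by
      apply Int.eq_zero_of_abs_lt_dvd h3
      have := i.2; have := i'.2
      rw [abs_lt]; constructor <;> omega
    ext; omega
  refine ⟨hi, ?_⟩
  subst hi
  unfold ptX at h
  have hp0 : (p : ℤ) ≠ 0 := by exact_mod_cast hp.ne_zero
  have h2 : (p : ℤ) * j = p * j' := by linarith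
  have := mul_left_cancel₀ hp0 h2
  ext; exact_mod_cast this

end E1Part

section E2Part

open Polynomial in
lemma main_det (p K Rm y h : ℕ) (X : ℝ) (hp : 0 < p) (hy : 0 < y) (hX : 0 ≤ X)
    (z : GaussianInt) (hn : z.norm = y) (ω lam : ℝ) (b : ℤ)
    (h1 : GaussianInt.toComplex z = Complex.exp (ω * Complex.I) *
      (starRingEnd ℂ) (GaussianInt.toComplex z))
    (h2 : p * ω = Real.pi / 2 * b + lam) (h3 : 0 < lam) (h4 : lam ≤ Real.pi * p / (y : ℝ) ^ h)
    (hpert : (16 : ℝ) ^ (9 * K) * (4 * Real.pi * Rm) ≤ (y : ℝ) ^ h)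
    (r s : Fin K × Fin 9 → ℤ) (hr : ∀ j, (r j).natAbs ≤ Rm)
    (hx : ∀ j, |((r j * b + s j * p : ℤ) : ℝ)| ≤ X)
    (hdet : (Matrix.of fun i j : Fin K × Fin 9 =>
      (binP i.1).eval ((r j * b + s j * p : ℤ) : ℂ) *
      Complex.exp (Complex.I * ((((i.2 : ℕ) : ℤ) - 4 : ℤ) *
        (ω * r j + Real.pi / 2 * s j) : ℝ))).det ≠ 0) :
    (16 : ℝ) ^ (9 * K * (9 * K - 1) / 2) ≤
      (∏ i : Fin K × Fin 9, (y : ℝ) ^ ((((i.2 : ℕ) : ℤ) - 4).natAbs * Rm)) *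
      (((9 * K).factorial : ℝ) * ∏ i : Fin K × Fin 9,
        (3 * ((4096 : ℝ) ^ (i.1 : ℕ) * Real.exp ((16 * X + K) / 4096)) *
          Real.exp (Real.pi * ((((i.2 : ℕ) : ℤ) - 4).natAbs : ℝ) / (2 * p) * (16 * X)))) := by
  have hcard : Fintype.card (Fin K × Fin 9) = 9 * K := by simp [mul_comm]
  have hpR : (0 : ℝ) < p := by exact_mod_cast hp
  have hyR : (0 : ℝ) < y := by exact_mod_cast hy
  set M : Matrix (Fin K × Fin 9) (Fin K × Fin 9) ℂ := Matrix.of fun i j : Fin K × Fin 9 =>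
      (binP i.1).eval ((r j * b + s j * p : ℤ) : ℂ) *
      Complex.exp (Complex.I * ((((i.2 : ℕ) : ℤ) - 4 : ℤ) *
        (ω * r j + Real.pi / 2 * s j) : ℝ)) with hM
  set ll : Fin K × Fin 9 → ℤ := fun i => ((i.2 : ℕ) : ℤ) - 4 with hll
  set x : Fin K × Fin 9 → ℤ := fun j => r j * b + s j * p with hxdef
  set B : Fin K × Fin 9 → ℝ := fun i => (4096 : ℝ) ^ (i.1 : ℕ) * Real.exp ((16 * X + K) / 4096)
    with hB
  set T : Fin K × Fin 9 → ℝ := fun i =>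
    Real.exp (Real.pi * ((ll i).natAbs : ℝ) / (2 * p) * (16 * X)) with hT
  set c : Fin K × Fin 9 → ℂ := fun i => Complex.I * ((Real.pi * (ll i) / (2 * p) : ℝ) : ℂ) with hc
  have hcn : ∀ i, ‖c i‖ = Real.pi * ((ll i).natAbs : ℝ) / (2 * p) := by
    intro i
    simp only [hc]
    rw [norm_mul, Complex.norm_I, one_mul, Complex.norm_real, Real.norm_eq_abs, abs_div, abs_mul,
      abs_of_pos Real.pi_pos, abs_of_pos (by positivity : (0:ℝ) < 2 * p), Nat.cast_natAbs,
      Int.cast_abs]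
  have hBpos : ∀ i, 0 < B i := fun i => by simp only [hB]; positivity
  have hT1 : ∀ i, 1 ≤ T i := fun i => by
    simp only [hT]; apply Real.one_le_exp; positivity
  have hr16 : (0 : ℝ) ≤ 16 * X := by positivity
  have hmB : ∀ i, maj (binP i.1) (16 * X) ≤ B i := fun i =>
    maj_binP i.1 K i.1.2.le hr16
  set f : Fin K × Fin 9 → ℂ[X] := fun i => binP i.1 * expT (c i) (9 * K) with hf
  have hfd : ∀ i, (f i).natDegree < 9 * K + K := by
    intro i
    refine lt_of_le_of_lt natDegree_mul_le ?_
    have := expT_natDegree (c i) (9 * K)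
    have h5 := i.1.2
    rw [binP_natDegree]
    omega
  have hmf : ∀ i, maj (f i) (16 * X) ≤ B i * T i := by
    intro i
    refine (maj_mul_le _ _ hr16).trans ?_
    refine mul_le_mul (hmB i) ?_ (maj_nonneg _ hr16) (hBpos i).le
    refine (maj_expT (c i) (9 * K) hr16).trans ?_
    rw [hcn]
  have hxX : ∀ j, ‖((x j : ℤ) : ℂ)‖ ≤ X := by
    intro j
    rw [Complex.norm_intCast]; exact hx j
  have hdiff : ∀ i j, ‖Complex.exp (Complex.I * ((ll i) * (ω * r j + Real.pi / 2 * s j) : ℝ))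
      - (expT (c i) (9 * K)).eval ((x j : ℤ) : ℂ)‖ ≤ 2 * T i / 16 ^ (9 * K) := by
    intro i j
    have e1 : Complex.I * (((ll i) * (ω * r j + Real.pi / 2 * s j) : ℝ) : ℂ) =
        c i * ((x j : ℤ) : ℂ) + Complex.I * ((ll i * lam * r j / p : ℝ) : ℂ) := by
      simp only [hc]
      rw [mul_assoc, ← Complex.ofReal_intCast (x j), ← Complex.ofReal_mul, ← mul_add,
        ← Complex.ofReal_add]
      congr 2
      simp only [hxdef]
      push_cast
      field_simp
      linear_combination (2 * (ll i : ℝ) * r j) * h2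
    have e2 : c i * ((x j : ℤ) : ℂ) = Complex.I * ((Real.pi * (ll i) / (2 * p) * x j : ℝ) : ℂ) := by
      simp only [hc]; push_cast; ring
    have n1 : ‖Complex.exp (c i * ((x j : ℤ) : ℂ))‖ = 1 := by
      rw [e2, mul_comm]; exact Complex.norm_exp_ofReal_mul_I _
    have n2 : ‖Complex.exp (c i * ((x j : ℤ) : ℂ)) - (expT (c i) (9 * K)).eval ((x j : ℤ) : ℂ)‖ ≤
        T i / 16 ^ (9 * K) := by
      refine (expT_tail (c i) _ (9 * K) (ρ := 16) (by norm_num)).trans ?_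
      gcongr
      simp only [hT]
      rw [Real.exp_le_exp, hcn]
      have := hxX j
      calc _ = Real.pi * ((ll i).natAbs : ℝ) / (2 * p) * (16 * ‖((x j : ℤ) : ℂ)‖) := by ring
        _ ≤ _ := by gcongr
    have n3 : ‖Complex.exp (Complex.I * ((ll i * lam * r j / p : ℝ) : ℂ)) - 1‖ ≤
        T i / 16 ^ (9 * K) := by
      refine (Real.norm_exp_I_mul_ofReal_sub_one_le).trans ?_
      rw [Real.norm_eq_abs, abs_div, abs_mul, abs_mul, abs_of_pos h3, abs_of_pos hpR]
      have a1 : |(ll i : ℝ)| ≤ 4 := by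
        have := i.2.2
        have : |ll i| ≤ 4 := by simp only [hll]; rw [abs_le]; constructor <;> omega
        exact_mod_cast this
      have a2 : |(r j : ℝ)| ≤ Rm := by
        have := hr j
        rw [← Int.cast_abs, ← Nat.cast_natAbs]; exact_mod_cast this
      have hyh : (0:ℝ) < (y:ℝ) ^ h := by positivity
      calc |(ll i : ℝ)| * lam * |(r j : ℝ)| / p ≤ 4 * (Real.pi * p / (y : ℝ) ^ h) * Rm / p := by
            gcongr
        _ = (4 * Real.pi * Rm) / (y : ℝ) ^ h := by field_simp
        _ ≤ 1 / 16 ^ (9 * K) := by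
            rw [div_le_div_iff₀ hyh (by positivity)]; linarith
        _ ≤ T i / 16 ^ (9 * K) := by gcongr; exact hT1 i
    rw [e1, Complex.exp_add]
    calc _ = ‖Complex.exp (c i * ((x j : ℤ) : ℂ)) *
          (Complex.exp (Complex.I * ((ll i * lam * r j / p : ℝ) : ℂ)) - 1) +
          (Complex.exp (c i * ((x j : ℤ) : ℂ)) - (expT (c i) (9 * K)).eval ((x j : ℤ) : ℂ))‖ := by
            congr 1; ring
      _ ≤ 1 * (T i / 16 ^ (9 * K)) + T i / 16 ^ (9 * K) := by
          refine (norm_add_le _ _).trans ?_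
          rw [norm_mul, n1]
          gcongr
      _ = _ := by ring
  have hub := det_bound (D := 9 * K + K) (fun i m => (f i).coeff m) (fun j => ((x j : ℤ) : ℂ)) M
    (fun i j => (binP i.1).eval ((x j : ℤ) : ℂ) *
      (Complex.exp (Complex.I * ((ll i) * (ω * r j + Real.pi / 2 * s j) : ℝ))
      - (expT (c i) (9 * K)).eval ((x j : ℤ) : ℂ))) (by
      intro i j
      have := eval_eq_sum_range' (hfd i) ((x j : ℤ) : ℂ)
      rw [Fin.sum_univ_eq_sum_range (fun m => (f i).coeff m * ((x j : ℤ) : ℂ) ^ m), ← this]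
      simp only [hf, eval_mul, hM, Matrix.of_apply]
      ring) X 16 hX (by norm_num) hxX (fun i => 2 * (B i * T i))
      (fun i => by have := hBpos i; have := hT1 i; positivity) (by
      intro i j
      rw [norm_mul, hcard]
      have n1 : ‖(binP i.1).eval ((x j : ℤ) : ℂ)‖ ≤ B i :=
        (norm_eval_le_maj _ _ ((hxX j).trans (by linarith))).trans (hmB i)
      calc _ ≤ B i * (2 * T i / 16 ^ (9 * K)) := by
            have := hBpos i
            gcongr
            exact hdiff i j
        _ = _ := by ring)
  have hlb := det_lower M (fun i => (y : ℝ) ^ ((ll i).natAbs * Rm)) (fun i => by positivity) (by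
    intro i j
    obtain ⟨g, hg⟩ := gauss_entry y z hn ω h1 Rm (ll i) (r j) (s j) (hr j)
    obtain ⟨n, hn'⟩ := binP_int i.1 (x j)
    refine ⟨(n : GaussianInt) * g, ?_⟩
    have hMij : M i j = n *
        Complex.exp (Complex.I * ((ll i) * (ω * r j + Real.pi / 2 * s j) : ℝ)) := by
      rw [← hn']; rfl
    rw [map_mul, map_intCast, hg, hMij, Complex.ofReal_pow, Complex.ofReal_natCast]
    ring) hdet
  rw [hcard] at hub
  have hprod : ∏ i, (∑ m : Fin (9 * K + K), ‖(f i).coeff m‖ * (16 * X) ^ (m : ℕ) + 2 * (B i * T i))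
      ≤ ∏ i, (3 * B i * T i) := by
    apply Finset.prod_le_prod
    · intro i _
      have := hBpos i; have := hT1 i
      positivity
    · intro i _
      rw [← maj_eq (f i) (16 * X) _ (hfd i)]
      have := hmf i
      linarith
  have hV : 0 < ∏ i, (y : ℝ) ^ ((ll i).natAbs * Rm) := Finset.prod_pos fun i _ => by positivity
  have h16 : (0:ℝ) < 16 ^ (9 * K * (9 * K - 1) / 2) := by positivity
  have hfin : 1 ≤ (∏ i, (y : ℝ) ^ ((ll i).natAbs * Rm)) * (((9 * K).factorial : ℝ) *
      (∏ i, (3 * B i * T i)) / 16 ^ (9 * K * (9 * K - 1) / 2)) := by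
    refine hlb.trans (mul_le_mul_of_nonneg_left (hub.trans ?_) hV.le)
    gcongr
  rw [← mul_div_assoc, one_le_div h16] at hfin
  exact hfin

end E2Part

section E3Part

open Polynomial in
lemma exists_pts (p K S R : ℕ) (b : ℤ) (ω lam : ℝ) (hp : p.Prime) (hb : ¬ (p : ℤ) ∣ b)
    (h2 : p * ω = Real.pi / 2 * b + lam) (h3 : 0 < lam) (hlam : 8 * lam < Real.pi / 2)
    (hR : 2 * R + 1 ≤ p) (hcard : 9 * (K - 1) < (2 * R + 1) * S) :
    ∃ r s : Fin K × Fin 9 → ℤ, (∀ j, (r j).natAbs ≤ R + 4) ∧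
      (∀ j, |((r j * b + s j * p : ℤ) : ℝ)| ≤ p * (S + 1) / 2) ∧
      (Matrix.of fun i j : Fin K × Fin 9 =>
        (binP i.1).eval ((r j * b + s j * p : ℤ) : ℂ) *
        Complex.exp (Complex.I * ((((i.2 : ℕ) : ℤ) - 4 : ℤ) *
          (ω * r j + Real.pi / 2 * s j) : ℝ))).det ≠ 0 := by
  have hp0 : (0 : ℤ) < p := by exact_mod_cast hp.pos
  have hpR : (0 : ℝ) < p := by exact_mod_cast hp.pos
  set rb : Fin (2 * R + 1) × Fin S → ℤ := fun u => (u.1 : ℤ) - R with hrb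
  set sb : Fin (2 * R + 1) × Fin S → ℤ := fun u => ptS p b S (rb u) u.2 with hsb
  set rt : Fin 9 → ℤ := fun t => (t : ℤ) - 4 with hrt
  set st : Fin 9 → ℤ := fun t => ptS p b 1 (rt t) 0 with hst
  set η : ℤ → ℤ → ℂ := fun r s => Complex.exp (Complex.I * ((ω * r + Real.pi / 2 * s : ℝ) : ℂ))
    with hη
  have hηne : ∀ r s, η r s ≠ 0 := fun r s => Complex.exp_ne_zero _
  have hηadd : ∀ r s r' s', η (r + r') (s + s') = η r s * η r' s' := by
    intro r s r' s'
    simp only [hη]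
    rw [← Complex.exp_add]
    congr 1
    push_cast; ring
  have hxb : ∀ u, rb u * b + sb u * p = ptX p b S (rb u) u.2 := fun u => (ptX_eq _ _ _ _ _).symm
  have hxt : ∀ t, rt t * b + st t * p = ptX p b 1 (rt t) 0 := fun u => by
    simp only [hst]; rw [ptX_eq]
  set M : Matrix (Fin K × Fin 9) ((Fin (2 * R + 1) × Fin S) × Fin 9) ℂ := Matrix.of fun i j =>
      (binP i.1).eval (((rb j.1 + rt j.2) * b + (sb j.1 + st j.2) * p : ℤ) : ℂ) *
        Complex.exp (Complex.I * ((((i.2 : ℕ) : ℤ) - 4 : ℤ) *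
          (ω * (rb j.1 + rt j.2 : ℤ) + Real.pi / 2 * (sb j.1 + st j.2 : ℤ)) : ℝ)) with hM
  have hηt : Function.Injective (fun t => η (rt t) (st t)) := by
    intro t t' htt
    simp only [hη] at htt
    rw [Complex.exp_eq_exp_iff_exists_int] at htt
    obtain ⟨n, hn⟩ := htt
    have e1 : (ω * rt t + Real.pi / 2 * st t) = (ω * rt t' + Real.pi / 2 * st t') +
        n * (2 * Real.pi) := by
      have : Complex.I * ((ω * rt t + Real.pi / 2 * st t : ℝ) : ℂ) = Complex.I *
          (((ω * rt t' + Real.pi / 2 * st t') + n * (2 * Real.pi) : ℝ) : ℂ) := by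
        rw [hn]; push_cast; ring
      exact_mod_cast mul_left_cancel₀ Complex.I_ne_zero this
    have e2 : lam * (((t : ℕ) : ℝ) - ((t' : ℕ) : ℝ)) = Real.pi / 2 *
        ((p * (st t' - st t) + 4 * n * p - ((t : ℤ) - (t' : ℤ)) * b : ℤ) : ℝ) := by
      simp only [hrt] at e1
      push_cast at e1 ⊢
      linear_combination (p : ℝ) * e1 - ((t : ℝ) - (t' : ℝ)) * h2
    set w : ℤ := p * (st t' - st t) + 4 * n * p - ((t : ℤ) - (t' : ℤ)) * b with hw
    have hd : |((t : ℕ) : ℝ) - ((t' : ℕ) : ℝ)| ≤ 8 := by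
      have h5 := t.2
      have h6 := t'.2
      have : |((t : ℕ) : ℤ) - ((t' : ℕ) : ℤ)| ≤ 8 := by rw [abs_le]; constructor <;> omega
      exact_mod_cast this
    have hw0 : w = 0 := by
      by_contra hne
      have h7 : (1 : ℝ) ≤ |(w : ℝ)| := by exact_mod_cast Int.one_le_abs hne
      have h8 : |lam * (((t : ℕ) : ℝ) - ((t' : ℕ) : ℝ))| ≤ lam * 8 := by
        rw [abs_mul, abs_of_pos h3]; gcongr
      rw [e2, abs_mul, abs_of_pos (by positivity)] at h8
      have := Real.pi_pos
      nlinarith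
    rw [hw0] at e2
    have h9 : ((t : ℕ) : ℝ) - ((t' : ℕ) : ℝ) = 0 := by
      have : lam * (((t : ℕ) : ℝ) - ((t' : ℕ) : ℝ)) = 0 := by rw [e2]; simp
      exact (mul_eq_zero.1 this).resolve_left h3.ne'
    have h10 : ((t : ℕ) : ℝ) = ((t' : ℕ) : ℝ) := by linarith
    ext; exact_mod_cast h10
  have hli : LinearIndependent ℂ M.row := by
    rw [Fintype.linearIndependent_iff]
    intro g hg
    have key := zero_estimate (L := 9) (fun k : Fin K => binP k) (binP_li K)
      (fun k => by rw [binP_natDegree]; omega)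
      (fun u : Fin (2 * R + 1) × Fin S => ((rb u * b + sb u * p : ℤ) : ℂ))
      (fun u => η (rb u) (sb u)) (by
        intro u u' huu
        simp only [hxb] at huu
        have := ptX_inj p b hp hb S R hR u.1 u'.1 u.2 u'.2 (Int.cast_injective huu)
        exact Prod.ext this.1 this.2) (fun u => hηne _ _) (by simpa using hcard)
      (fun t => ((rt t * b + st t * p : ℤ) : ℂ)) (fun t => η (rt t) (st t)) hηt
      (fun k l => g (k, l)) (by
        intro u t
        have h5 := congrFun hg (u, t)
        simp only [Finset.sum_apply, Pi.smul_apply, smul_eq_mul, Pi.zero_apply, Matrix.row] at h5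
        rw [Fintype.sum_prod_type] at h5
        have h6 := congrArg (fun v => (η (rb u + rt t) (sb u + st t)) ^ 4 * v) h5
        simp only [mul_zero] at h6
        rw [← h6, Finset.mul_sum]
        apply Finset.sum_congr rfl
        intro k _
        rw [Finset.mul_sum]
        apply Finset.sum_congr rfl
        intro l _
        rw [← hηadd]
        have h7 : M (k, l) (u, t) = (binP k).eval (((rb u * b + sb u * p : ℤ) : ℂ) +
            ((rt t * b + st t * p : ℤ) : ℂ)) * ((η (rb u + rt t) (sb u + st t)) ^ (l : ℕ) *
            ((η (rb u + rt t) (sb u + st t)) ^ 4)⁻¹) := by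
          simp only [hM, Matrix.of_apply]
          congr 1
          · congr 1
            push_cast; ring
          · simp only [hη]
            rw [← Complex.exp_nat_mul, ← Complex.exp_nat_mul, ← Complex.exp_neg,
              ← Complex.exp_add]
            congr 1
            push_cast; ring
        rw [h7]
        have := hηne (rb u + rt t) (sb u + st t)
        field_simp)
    intro i
    exact congrFun (congrFun key i.1) i.2
  obtain ⟨e, he⟩ := exists_minor M hli
  refine ⟨fun j => rb (e j).1 + rt (e j).2, fun j => sb (e j).1 + st (e j).2, ?_, ?_, he⟩
  · intro j
    have h5 := (e j).1.1.2
    have h6 := (e j).2.2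
    simp only [hrb, hrt]
    omega
  · intro j
    have e1 : (rb (e j).1 + rt (e j).2) * b + (sb (e j).1 + st (e j).2) * p =
        ptX p b S (rb (e j).1) (e j).1.2 + ptX p b 1 (rt (e j).2) 0 := by
      rw [← hxb, ← hxt]; ring
    rw [e1]
    have a1 := ptX_abs p b hp0 S (rb (e j).1) (e j).1.2 (e j).1.2.2
    have a2 := ptX_abs p b hp0 1 (rt (e j).2) 0 (by norm_num)
    have a3 : |2 * (ptX p b S (rb (e j).1) (e j).1.2 + ptX p b 1 (rt (e j).2) 0)| ≤
        (p : ℤ) * S + p * (1 : ℕ) := by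
      rw [mul_add]; exact (abs_add_le _ _).trans (add_le_add a1 a2)
    have a4 : |2 * ((ptX p b S (rb (e j).1) (e j).1.2 + ptX p b 1 (rt (e j).2) 0 : ℤ) : ℝ)| ≤
        (p : ℝ) * S + p * (1 : ℕ) := by exact_mod_cast a3
    rw [abs_mul, abs_of_pos (by norm_num : (0:ℝ) < 2)] at a4
    push_cast at a4 ⊢
    linarith

end E3Part

section F1Part

lemma log_form (p K Rm y : ℕ) (X : ℝ) (hK : 0 < K) (hy : 0 < y)
    (H : (16 : ℝ) ^ (9 * K * (9 * K - 1) / 2) ≤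
      (∏ i : Fin K × Fin 9, (y : ℝ) ^ ((((i.2 : ℕ) : ℤ) - 4).natAbs * Rm)) *
      (((9 * K).factorial : ℝ) * ∏ i : Fin K × Fin 9,
        (3 * ((4096 : ℝ) ^ (i.1 : ℕ) * Real.exp ((16 * X + K) / 4096)) *
          Real.exp (Real.pi * ((((i.2 : ℕ) : ℤ) - 4).natAbs : ℝ) / (2 * p) * (16 * X))))) :
    (9 * K - 1) / 2 * (4 * Real.log 2) ≤ 20 / 9 * (Rm * Real.log y) + Real.log (9 * K) +
      Real.log 3 + (K - 1) / 2 * (12 * Real.log 2) + (16 * X + K) / 4096 +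
      20 / 9 * (Real.pi / (2 * p) * (16 * X)) := by
  have hyR : (0 : ℝ) < y := by exact_mod_cast hy
  have hKR : (0 : ℝ) < K := by exact_mod_cast hK
  have hfac : (((9 * K).factorial : ℕ) : ℝ) ≤ (9 * K : ℝ) ^ (9 * K) := by
    exact_mod_cast Nat.factorial_le_pow (9 * K)
  have hl := Real.log_le_log (by positivity) H
  have p1 : (∏ i : Fin K × Fin 9, (y : ℝ) ^ ((((i.2 : ℕ) : ℤ) - 4).natAbs * Rm)) ≠ 0 :=
    Finset.prod_ne_zero_iff.2 fun i _ => by positivity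
  have p2 : (∏ i : Fin K × Fin 9,
        (3 * ((4096 : ℝ) ^ (i.1 : ℕ) * Real.exp ((16 * X + K) / 4096)) *
          Real.exp (Real.pi * ((((i.2 : ℕ) : ℤ) - 4).natAbs : ℝ) / (2 * p) * (16 * X)))) ≠ 0 :=
    Finset.prod_ne_zero_iff.2 fun i _ => by positivity
  have p3 : (((9 * K).factorial : ℕ) : ℝ) ≠ 0 := by positivity
  rw [Real.log_mul p1 (mul_ne_zero p3 p2), Real.log_mul p3 p2, Real.log_prod (fun i _ => by positivity),
    Real.log_prod (fun i _ => by positivity), Real.log_pow] at hl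
  have q0 : ((9 * K * (9 * K - 1) / 2 : ℕ) : ℝ) = 9 * K * (9 * K - 1) / 2 := by
    rw [Nat.cast_div (even_iff_two_dvd.1 (Nat.even_mul_pred_self _)) (by norm_num), Nat.cast_mul,
      Nat.cast_sub (by omega)]
    push_cast; ring
  have q1 : ∑ i : Fin K × Fin 9, Real.log ((y : ℝ) ^ ((((i.2 : ℕ) : ℤ) - 4).natAbs * Rm)) =
      K * (20 * (Rm * Real.log y)) := by
    rw [Fintype.sum_prod_type]
    simp only [Real.log_pow]
    rw [Finset.sum_const, Finset.card_univ, Fintype.card_fin, nsmul_eq_mul]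
    congr 1
    simp only [Fin.sum_univ_succ]
    norm_num
    ring
  have q2 : ∑ i : Fin K × Fin 9, Real.log
        (3 * ((4096 : ℝ) ^ (i.1 : ℕ) * Real.exp ((16 * X + K) / 4096)) *
          Real.exp (Real.pi * ((((i.2 : ℕ) : ℤ) - 4).natAbs : ℝ) / (2 * p) * (16 * X))) =
      9 * K * Real.log 3 + 9 * (K * (K - 1) / 2) * (12 * Real.log 2) +
      9 * K * ((16 * X + K) / 4096) + K * (20 * (Real.pi / (2 * p) * (16 * X))) := by
    have t1 : ∀ i : Fin K × Fin 9, Real.log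
        (3 * ((4096 : ℝ) ^ (i.1 : ℕ) * Real.exp ((16 * X + K) / 4096)) *
          Real.exp (Real.pi * ((((i.2 : ℕ) : ℤ) - 4).natAbs : ℝ) / (2 * p) * (16 * X))) =
        Real.log 3 + ((i.1 : ℕ) : ℝ) * (12 * Real.log 2) + (16 * X + K) / 4096 +
        ((((i.2 : ℕ) : ℤ) - 4).natAbs : ℝ) * (Real.pi / (2 * p) * (16 * X)) := by
      intro i
      rw [Real.log_mul (by positivity) (by positivity), Real.log_mul (by positivity) (by positivity),
        Real.log_mul (by positivity) (by positivity), Real.log_exp, Real.log_exp, Real.log_pow,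
        show (4096 : ℝ) = 2 ^ 12 by norm_num, Real.log_pow]
      push_cast; ring
    simp only [t1]
    rw [Fintype.sum_prod_type]
    have t2 : ∀ k : Fin K, ∑ l : Fin 9, (Real.log 3 + ((k : ℕ) : ℝ) * (12 * Real.log 2) +
        (16 * X + K) / 4096 + ((((l : ℕ) : ℤ) - 4).natAbs : ℝ) * (Real.pi / (2 * p) * (16 * X))) =
        9 * Real.log 3 + 9 * ((16 * X + K) / 4096) + 20 * (Real.pi / (2 * p) * (16 * X)) +
        ((k : ℕ) : ℝ) * (9 * (12 * Real.log 2)) := by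
      intro k
      simp only [Fin.sum_univ_succ]
      norm_num
      ring
    simp only [t2]
    rw [Finset.sum_add_distrib, ← Finset.sum_mul, Finset.sum_const, Finset.card_univ,
      Fintype.card_fin, nsmul_eq_mul, Fin.sum_univ_eq_sum_range (fun k => (k : ℝ))]
    have t3 : ∑ k ∈ Finset.range K, (k : ℝ) = K * (K - 1) / 2 := by
      have := Finset.sum_range_id_mul_two K
      have h5 : ((∑ k ∈ Finset.range K, k : ℕ) : ℝ) * 2 = K * (K - 1) := by
        have h6 : ((K - 1 : ℕ) : ℝ) = K - 1 := by rw [Nat.cast_sub hK]; simp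
        rw [← h6]; exact_mod_cast this
      push_cast at h5
      linarith
    rw [t3]
    ring
  have q3 : Real.log (((9 * K).factorial : ℕ) : ℝ) ≤ 9 * K * Real.log (9 * K) := by
    refine (Real.log_le_log (by positivity) hfac).trans ?_
    rw [Real.log_pow]; push_cast; exact le_rfl
  have q4 : Real.log 16 = 4 * Real.log 2 := by
    rw [show (16 : ℝ) = 2 ^ 4 by norm_num, Real.log_pow]; norm_num
  rw [q0, q1, q2, q4] at hl
  have h9K : (0:ℝ) < 9 * K := by positivity
  refine le_of_mul_le_mul_left ?_ h9K
  calc _ = 9 * K * (9 * K - 1) / 2 * (4 * Real.log 2) := by ring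
    _ ≤ _ := hl
    _ ≤ _ := by
      have := q3
      linarith

lemma numerics (p h K R S y : ℕ) (hp : 3090 ≤ p) (hph : p = 2 * h + 1) (hR : R = p / 48)
    (hy : p ^ 2 ≤ 2 * y) (hK : y ^ (h - 1) < (16 ^ 9) ^ (K + 1))
    (hS : S = 9 * (K - 1) / (2 * R + 1) + 1) (hK0 : 0 < K)
    (H : ((9 : ℝ) * K - 1) / 2 * (4 * Real.log 2) ≤ 20 / 9 * ((R + 4 : ℕ) * Real.log y) +
      Real.log (9 * K) +
      Real.log 3 + (K - 1) / 2 * (12 * Real.log 2) + (16 * ((p : ℝ) * (S + 1) / 2) + K) / 4096 +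
      20 / 9 * (Real.pi / (2 * p) * (16 * ((p : ℝ) * (S + 1) / 2)))) : False := by
  have hpR : (3090 : ℝ) ≤ p := by exact_mod_cast hp
  have hKR : (0 : ℝ) < K := by exact_mod_cast hK0
  have l1 := Real.log_two_gt_d9
  have l2 := Real.log_two_lt_d9
  have hy22 : 2 ^ 22 ≤ y := by nlinarith
  have hyR : (2 : ℝ) ^ 22 ≤ y := by exact_mod_cast hy22
  have hl : 22 * Real.log 2 ≤ Real.log y := by
    have := Real.log_le_log (by positivity) hyR
    rw [Real.log_pow] at this
    exact_mod_cast this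
  have hKl : ((p : ℝ) - 3) / 2 * Real.log y < 36 * (K + 1) * Real.log 2 := by
    have h1 : (y : ℝ) ^ (h - 1) < (16 ^ 9) ^ (K + 1) := by exact_mod_cast hK
    have h2 := Real.log_lt_log (by positivity) h1
    rw [Real.log_pow, Real.log_pow, Nat.cast_sub (by omega),
      show (16 : ℝ) ^ 9 = 2 ^ 36 by norm_num, Real.log_pow] at h2
    have h3 : (p : ℝ) = 2 * h + 1 := by exact_mod_cast hph
    push_cast at h2
    rw [h3]
    linarith
  have hl0 : 0 < Real.log 2 := by linarith
  have hpK : 11 * ((p : ℝ) - 3) < 36 * (K + 1) := by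
    have : ((p : ℝ) - 3) / 2 * (22 * Real.log 2) ≤ ((p : ℝ) - 3) / 2 * Real.log y := by
      apply mul_le_mul_of_nonneg_left hl; linarith
    have h4 : (11 * ((p : ℝ) - 3)) * Real.log 2 < (36 * (K + 1)) * Real.log 2 := by linarith
    exact lt_of_mul_lt_mul_right h4 hl0.le
  have hK940 : (940 : ℝ) < K := by linarith
  have hR1 : (R : ℝ) ≤ p / 48 := by
    rw [hR]; exact Nat.cast_div_le
  have hR2 : ((p : ℝ) - 23) / 24 ≤ 2 * R + 1 := by
    have : p ≤ 48 * R + 47 := by omega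
    have : (p : ℝ) ≤ 48 * R + 47 := by exact_mod_cast this
    linarith
  have hS1 : (S : ℝ) ≤ 217.65 * K / p + 1 := by
    have h1 : ((9 * (K - 1) / (2 * R + 1) : ℕ) : ℝ) ≤ ((9 * (K - 1) : ℕ) : ℝ) / ((2 * R + 1 : ℕ) : ℝ) :=
      Nat.cast_div_le
    have h2 : ((9 * (K - 1) : ℕ) : ℝ) ≤ 9 * K := by
      have : 9 * (K - 1) ≤ 9 * K := by omega
      exact_mod_cast this
    have h3 : ((9 * (K - 1) : ℕ) : ℝ) / ((2 * R + 1 : ℕ) : ℝ) ≤ 217.65 * K / p := by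
      rw [div_le_div_iff₀ (by positivity) (by linarith)]
      push_cast at h2 ⊢
      have h5 : 9 * (p : ℝ) ≤ 217.65 * (2 * R + 1) := by linarith
      calc _ ≤ 9 * (K : ℝ) * p := by gcongr
        _ = K * (9 * p) := by ring
        _ ≤ K * (217.65 * (2 * R + 1)) := by gcongr
        _ = _ := by ring
    rw [hS]; push_cast at h1 h3 ⊢; linarith
  have hpp : (0 : ℝ) < p := by linarith
  have hX : (p : ℝ) * (S + 1) / 2 ≤ 112.2 * K := by
    have : (p : ℝ) * (S + 1) ≤ p * (217.65 * K / p + 1 + 1) := by gcongr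
    have e : (p : ℝ) * (217.65 * K / p + 1 + 1) = 217.65 * K + 2 * p := by field_simp; ring
    linarith
  have hXp : 20 / 9 * (Real.pi / (2 * p) * (16 * ((p : ℝ) * (S + 1) / 2))) ≤ 2.1 * K := by
    have e : 20 / 9 * (Real.pi / (2 * p) * (16 * ((p : ℝ) * (S + 1) / 2))) =
        80 / 9 * Real.pi * (S + 1) := by field_simp; ring
    rw [e]
    have h1 : 217.65 * K / (p : ℝ) ≤ 217.65 * K / 3090 := by gcongr
    have h2 : (S : ℝ) + 1 ≤ 0.0726 * K := by linarith
    have h3 := Real.pi_lt_d4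
    calc 80 / 9 * Real.pi * ((S : ℝ) + 1) ≤ 80 / 9 * 3.1416 * (0.0726 * K) := by gcongr
      _ ≤ _ := by linarith
  have hRl : 20 / 9 * (((R + 4 : ℕ) : ℝ) * Real.log y) ≤ 3.55 * (K + 1) * Real.log 2 := by
    have h1 : ((R + 4 : ℕ) : ℝ) ≤ 0.02217 * (p - 3) := by push_cast; linarith
    have h2 : ((R + 4 : ℕ) : ℝ) * Real.log y ≤ 0.02217 * (p - 3) * Real.log y := by
      gcongr
    have : 0 ≤ (K + 1) * Real.log 2 := by positivity
    linarith
  have hlog : Real.log (9 * K) + Real.log 3 ≤ 27 * K / 2 ^ 15 - 1 + 15 * Real.log 2 := by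
    rw [← Real.log_mul (by positivity) (by norm_num)]
    have h1 := Real.log_le_sub_one_of_pos (show (0:ℝ) < 27 * K / 2 ^ 15 by positivity)
    rw [Real.log_div (by positivity) (by positivity), Real.log_pow] at h1
    rw [show (9 : ℝ) * K * 3 = 27 * K by ring]
    push_cast at h1
    linarith
  have hf : ((9 : ℝ) * K - 1) / 2 * (4 * Real.log 2) ≤ 3.55 * (K + 1) * Real.log 2 +
      (27 * K / 2 ^ 15 - 1 + 15 * Real.log 2) + (K - 1) / 2 * (12 * Real.log 2) +
      (16 * (112.2 * K) + K) / 4096 + 2.1 * K := by linarith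
  have hf2 : ((8.45 : ℝ) * K - 14.55) * Real.log 2 ≤ 2.55 * K := by linarith
  have : ((8.45 : ℝ) * K - 14.55) * 0.69 ≤ ((8.45 : ℝ) * K - 14.55) * Real.log 2 := by
    apply mul_le_mul_of_nonneg_left <;> linarith
  linarith

end F1Part

theorem bound_p_eq_q (p q m x y : ℕ)
    (hp : Nat.Prime p) (hop : Odd p) (hq : Nat.Prime q) (hoq : Odd q)
    (hpq : p = q) (hm : 1 ≤ m) (hx : 0 < x) (hy : 0 < y)
    (hcop : Nat.gcd x y = 1)
    (heq : x ^ 2 + q ^ (2 * m) = 2 * y ^ p) :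
    p ≤ 3089 := by
  by_contra hcon
  have hp3090 : 3090 ≤ p := by omega
  subst hpq
  obtain ⟨z, hz, hn, hyo, hpy, hpm⟩ := algebra_part p m x y hp hop hm hcop heq
  obtain ⟨h, hph⟩ := hop
  have hop : Odd p := ⟨h, hph⟩
  obtain ⟨ω, lam, b, h1, h2, h3, h4, h5⟩ :=
    linear_form p m x y h hx hy hp.pos hph z hz hn hpm
  have hy22 : 2 ^ 22 ≤ y := by nlinarith
  have hb : ¬ (p : ℤ) ∣ b :=
    not_dvd_b p y h hop (by omega) (by omega) hyo z hn ω lam b h1 h2 h3 h4 h5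
  obtain ⟨R, hR⟩ : ∃ R, R = p / 48 := ⟨_, rfl⟩
  obtain ⟨K, hK⟩ : ∃ K, K = Nat.log (16 ^ 9) (y ^ (h - 1)) := ⟨_, rfl⟩
  obtain ⟨S, hS⟩ : ∃ S, S = 9 * (K - 1) / (2 * R + 1) + 1 := ⟨_, rfl⟩
  have hKlt : y ^ (h - 1) < (16 ^ 9) ^ (K + 1) := by
    rw [hK]; exact Nat.lt_pow_succ_log_self (by norm_num) _
  have hKle : (16 ^ 9) ^ K ≤ y ^ (h - 1) := by
    rw [hK]; exact Nat.pow_log_le_self _ (pow_pos hy _).ne'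
  have hK0 : 0 < K := by
    rw [hK]
    apply Nat.log_pos (by norm_num)
    calc 16 ^ 9 ≤ (2 ^ 22) ^ 2 := by norm_num
      _ ≤ y ^ 2 := Nat.pow_le_pow_left hy22 2
      _ ≤ y ^ (h - 1) := Nat.pow_le_pow_right hy (by omega)
  have hpR : (3090 : ℝ) ≤ p := by exact_mod_cast hp3090
  have hpyR : (p : ℝ) ^ 2 ≤ 2 * y := by exact_mod_cast hpy
  have hyR : (0 : ℝ) < y := by exact_mod_cast hy
  have hpi4 := Real.pi_lt_d4
  have hpi0 := Real.pi_pos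
  have hR1 : (R : ℝ) ≤ p / 48 := by
    rw [hR]; exact Nat.cast_div_le
  have hyhle : (y : ℝ) ≤ (y : ℝ) ^ h := by
    have : y ^ 1 ≤ y ^ h := Nat.pow_le_pow_right hy (by omega)
    rw [pow_one] at this
    exact_mod_cast this
  have hlam : 8 * lam < Real.pi / 2 := by
    have e1 : Real.pi * p / (y : ℝ) ^ h ≤ Real.pi * p / y := by gcongr
    have e2 : Real.pi * p / y ≤ Real.pi / 20 := by
      rw [div_le_div_iff₀ hyR (by norm_num)]
      have : (p : ℝ) * 20 ≤ y := by nlinarith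
      nlinarith
    linarith
  have hpert : (16 : ℝ) ^ (9 * K) * (4 * Real.pi * (R + 4 : ℕ)) ≤ (y : ℝ) ^ h := by
    have e1 : (16 : ℝ) ^ (9 * K) ≤ (y : ℝ) ^ (h - 1) := by
      rw [pow_mul]; exact_mod_cast hKle
    have e2 : 4 * Real.pi * ((R + 4 : ℕ) : ℝ) ≤ y := by
      push_cast
      have e3 : (R : ℝ) + 4 ≤ p := by linarith
      have e4 : 4 * Real.pi * ((R : ℝ) + 4) ≤ 16 * p :=
        mul_le_mul (by linarith) e3 (by positivity) (by norm_num)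
      nlinarith
    calc _ ≤ (y : ℝ) ^ (h - 1) * y := mul_le_mul e1 e2 (by positivity) (by positivity)
      _ = (y : ℝ) ^ h := by rw [← pow_succ]; congr 1; omega
  obtain ⟨r, s, hr, hxx, hdet⟩ := exists_pts p K S R b ω lam hp hb h2 h3 hlam (by omega)
    (by rw [hS]; exact Nat.lt_mul_div_succ _ (by omega))
  have key := main_det p K (R + 4) y h ((p : ℝ) * (S + 1) / 2) hp.pos hy (by positivity) z hn ω lam b
    h1 h2 h3 h4 hpert r s hr hxx hdet
  exact numerics p h K R S y hp3090 hph hR hpy hKlt hS hK0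
    (log_form p K (R + 4) y _ hK0 hy key)
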